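/- arXiv:1702.00516 — 2 statements merged into one kernel-verified Lean document; each statement's English description precedes it below -/
import Mathlib

section
/- Let K be a field, let p be a prime, and let L/K be a finite separable field extension of degree p. Let A be a central simple algebra over L which is split by some finite separable field extension of L of degree coprime to p (equivalently, the index of A is coprime to p). Then there exists a finite field extension M/K with [M : K] coprime to p such that A ⊗_L (L ⊗_K M) is a split algebra, i.e., isomorphic to a matrix algebra over each field factor of the étale L-algebra L ⊗_K M. -/
open scoped TensorProduct
open Module

set_option synthInstance.maxHeartbeats 400000
set_option maxHeartbeats 800000

/-- The normal closure of a separable algebraic extension is Galois. -/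
theorem IntermediateField.isGalois_normalClosure (K L Ω : Type*) [Field K] [Field L] [Field Ω]
    [Algebra K L] [Algebra K Ω] [Algebra.IsSeparable K L] [Normal K Ω] :
    IsGalois K (IntermediateField.normalClosure K L Ω) where
  to_isSeparable := by
    have (σ : L →ₐ[K] Ω) : Algebra.IsSeparable K σ.fieldRange :=
      AlgEquiv.Algebra.isSeparable (AlgEquiv.ofInjectiveField σ)
    exact IntermediateField.isSeparable_iSup K Ω
  to_normal := inferInstance

/-- A finite Galois extension of `K` inside `Ω` is an extension of `p`-power degree of some
subextension whose degree over `K` is coprime to `p`. -/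
theorem IntermediateField.exists_le_coprime_finrank_and_finrank_eq_pow
    {K Ω : Type*} [Field K] [Field Ω] [Algebra K Ω] (E : IntermediateField K Ω)
    [FiniteDimensional K E] [IsGalois K E] {p : ℕ} (hp : p.Prime) :
    ∃ M : IntermediateField K Ω, FiniteDimensional K M ∧ Nat.Coprime (finrank K M) p ∧
      ∃ (h : M ≤ E) (k : ℕ), finrank M (extendScalars h) = p ^ k := by
  have := Fact.mk hp
  obtain ⟨P⟩ : Nonempty (Sylow p Gal(E/K)) := inferInstance
  obtain ⟨k, hk⟩ := IsPGroup.iff_card.mp P.isPGroup'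
  let F : IntermediateField K E := fixedField (P : Subgroup Gal(E/K))
  have hFM : finrank K (lift F) = finrank K F := (liftAlgEquiv F).toLinearEquiv.finrank_eq.symm
  have hF : finrank K F = (P : Subgroup Gal(E/K)).index := by
    rw [finrank_eq_fixingSubgroup_index, fixingSubgroup_fixedField]
  have hFE : finrank F E = p ^ k := by
    rw [← hk]; exact finrank_fixedField_eq_card _
  have hle : lift F ≤ E := lift_le F
  refine ⟨lift F, Module.Finite.equiv (liftAlgEquiv F).toLinearEquiv, ?_, hle, k, ?_⟩
  · rw [hFM, hF]
    exact ((Nat.Prime.coprime_iff_not_dvd hp).mpr P.not_dvd_index).symm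
  · have h1 : finrank K (lift F) * finrank (lift F) (extendScalars hle) = finrank K E :=
      finrank_mul_finrank K (lift F) (extendScalars hle)
    have h2 : finrank K F * finrank F E = finrank K E := finrank_mul_finrank K F E
    rw [hFM, ← h2, hFE] at h1
    exact Nat.eq_of_mul_eq_mul_left finrank_pos h1

/-- A polynomial whose degree is not divisible by `p` has an irreducible factor whose degree is
not divisible by `p`. -/
theorem Polynomial.exists_irreducible_dvd_not_dvd_natDegree {F : Type*} [Field F] {p : ℕ}
    {f : Polynomial F} (hf : ¬ p ∣ f.natDegree) :
    ∃ g, Irreducible g ∧ g ∣ f ∧ ¬ p ∣ g.natDegree := by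
  induction f using UniqueFactorizationMonoid.induction_on_prime with
  | h₁ => simp at hf
  | h₂ x hx => simp [Polynomial.natDegree_eq_zero_of_isUnit hx] at hf
  | h₃ a q ha hq ih =>
    rw [Polynomial.natDegree_mul hq.ne_zero ha] at hf
    by_cases h : p ∣ q.natDegree
    · obtain ⟨g, hg, hga, hgp⟩ := ih fun h' ↦ hf (dvd_add h h')
      exact ⟨g, hg, hga.mul_left q, hgp⟩
    · exact ⟨q, hq.irreducible, dvd_mul_right _ _, h⟩

/-- Let `L/K` and `L'/L` be field extensions with `L'/L` finite separable of degree not divisible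
by `p`. Let `N/L` be a field extension with an embedding into `Ω` over `K`, and let `E` be an
intermediate field of `Ω/N` of `p`-power degree over `N` containing all `K`-conjugates of `L'`.
Then `L'` embeds into `N` over `L`. -/
theorem nonempty_algHom_of_finrank_eq_pow
    {K L L' N Ω : Type*} [Field K] [Field L] [Field L'] [Field N] [Field Ω]
    [Algebra K L] [Algebra L L'] [Algebra K L'] [IsScalarTower K L L']
    [FiniteDimensional L L'] [Algebra.IsSeparable L L']
    [Algebra L N] [Algebra N Ω] [Algebra L Ω] [IsScalarTower L N Ω]
    [Algebra K Ω] [IsScalarTower K L Ω] [IsAlgClosed Ω]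
    {p : ℕ} (hp : p.Prime) (hcop : Nat.Coprime (finrank L L') p)
    (E : IntermediateField N Ω) {j : ℕ} (hE : finrank N E = p ^ j)
    (hconj : ∀ σ : L' →ₐ[K] Ω, ∀ x, σ x ∈ E) :
    Nonempty (L' →ₐ[L] N) := by
  let pb := Field.powerBasisOfFiniteOfSeparable L L'
  have hndvd : ¬ p ∣ ((minpoly L pb.gen).map (algebraMap L N)).natDegree := by
    rw [Polynomial.natDegree_map, pb.natDegree_minpoly, ← pb.finrank]
    exact (Nat.Prime.coprime_iff_not_dvd hp).mp hcop.symm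
  obtain ⟨g, hg, hgdvd, hgp⟩ := Polynomial.exists_irreducible_dvd_not_dvd_natDegree hndvd
  obtain ⟨β, hβ⟩ := IsAlgClosed.exists_aeval_eq_zero Ω g
    (Polynomial.degree_pos_of_irreducible hg).ne'
  have hβ' : Polynomial.aeval β (minpoly L pb.gen) = 0 := by
    rw [← Polynomial.aeval_map_algebraMap N]
    exact Polynomial.aeval_eq_zero_of_dvd_aeval_eq_zero hgdvd hβ
  have hβE : β ∈ E := by
    have := hconj ((pb.lift β hβ').restrictScalars K) pb.gen
    rwa [AlgHom.restrictScalars_apply, pb.lift_gen] at this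
  have : FiniteDimensional N E := FiniteDimensional.of_finrank_pos (by
    rw [hE]; exact pow_pos hp.pos j)
  have hβ0 : Polynomial.aeval (⟨β, hβE⟩ : E) g = 0 := by
    apply (algebraMap E Ω).injective
    rw [← Polynomial.aeval_algebraMap_apply, map_zero]
    exact hβ
  have hdvd : g.natDegree ∣ p ^ j := by
    rw [← hE, minpoly.Irreducible.eq_minpoly hg hβ0,
      Polynomial.natDegree_C_mul (Polynomial.leadingCoeff_ne_zero.mpr hg.ne_zero)]
    exact minpoly.degree_dvd (Algebra.IsIntegral.isIntegral _)
  obtain ⟨i, -, hi⟩ := (Nat.dvd_prime_pow hp).mp hdvd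
  have hi0 : i = 0 := by
    by_contra h
    exact hgp (hi ▸ dvd_pow_self p h)
  obtain ⟨x, hx⟩ := Polynomial.exists_root_of_degree_eq_one
    ((Polynomial.degree_eq_iff_natDegree_eq hg.ne_zero).mpr (by rw [hi, hi0, pow_zero]; rfl))
  refine ⟨pb.lift x ?_⟩
  rw [← Polynomial.aeval_map_algebraMap N, Polynomial.coe_aeval_eq_eval]
  exact hx.dvd hgdvd

/-- Being a matrix algebra over a field is preserved by further field extension. -/
theorem exists_algEquiv_matrix_of_algHom
    {L L' N A : Type*} [Field L] [Field L'] [Field N] [Ring A] [Algebra L L'] [Algebra L N]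
    [Algebra L A] (ρ : L' →ₐ[L] N) {n : ℕ} (e : (L' ⊗[L] A) ≃ₐ[L'] Matrix (Fin n) (Fin n) L') :
    Nonempty ((N ⊗[L] A) ≃ₐ[N] Matrix (Fin n) (Fin n) N) := by
  let := ρ.toRingHom.toAlgebra
  have : IsScalarTower L L' N := IsScalarTower.of_algebraMap_eq fun x ↦ (ρ.commutes x).symm
  let e₁ : N ⊗[L'] (L' ⊗[L] A) ≃ₐ[N] N ⊗[L'] Matrix (Fin n) (Fin n) L' :=
    Algebra.TensorProduct.congr AlgEquiv.refl e
  let e₂ : N ⊗[L'] Matrix (Fin n) (Fin n) L' ≃ₐ[N] Matrix (Fin n) (Fin n) N :=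
    AlgEquiv.ofRingEquiv (f := (matrixEquivTensor (Fin n) L' N).symm.toRingEquiv) fun r ↦ by
      ext i j
      simp [Algebra.TensorProduct.algebraMap_apply, matrixEquivTensor_apply_symm,
        Matrix.algebraMap_matrix_apply, Matrix.one_apply]
  let e₀ : N ⊗[L] A ≃ₐ[N] N ⊗[L'] (L' ⊗[L] A) :=
    AlgEquiv.ofLinearEquiv (TensorProduct.AlgebraTensorModule.cancelBaseChange L L' N N A).symm
      (by simp [Algebra.TensorProduct.one_def])
      (LinearMap.map_mul_of_map_mul_tmul fun _ _ _ _ ↦ by simp)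
  exact ⟨e₀.trans (e₁.trans e₂)⟩

/-- Let `K` be a field, `p` a prime and `L/K` a finite separable field
extension of degree `p`. Let `A` be a central simple algebra over `L` that is split by some
finite separable field extension of `L` of degree coprime to `p` (equivalently, the index of
`A` is coprime to `p`). Then there is a finite field extension `M/K` of degree coprime to `p`
such that `A ⊗_L (L ⊗_K M)` is split, i.e. the base change of `A` to every field factor `N`
of the étale `L`-algebra `L ⊗_K M` is a matrix algebra. (Field factors `N` are encoded as
fields receiving `L` and `M` compatibly over `K` such that the induced map
`L ⊗[K] M → N` is surjective.) -/
theorem statement1 (K : Type) [Field K] (p : ℕ) (hp : p.Prime)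
    (L : Type) [Field L] [Algebra K L] [Algebra.IsSeparable K L]
    (hdeg : finrank K L = p)
    (A : Type) [Ring A] [Algebra L A] [FiniteDimensional L A]
    [Algebra.IsCentral L A] [IsSimpleRing A]
    (hsplit : ∃ N : IntermediateField L (AlgebraicClosure L),
      FiniteDimensional L N ∧ Algebra.IsSeparable L N ∧
      Nat.Coprime (finrank L N) p ∧
      ∃ n : ℕ, Nonempty ((N ⊗[L] A) ≃ₐ[N] Matrix (Fin n) (Fin n) N)) :
    ∃ M : IntermediateField K (AlgebraicClosure K),
      FiniteDimensional K M ∧ Nat.Coprime (finrank K M) p ∧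
      ∀ (N : Type) [Field N] [Algebra K N] [Algebra L N] [Algebra M N]
        [IsScalarTower K L N] [IsScalarTower K M N],
        Function.Surjective (Algebra.TensorProduct.productMap
          (IsScalarTower.toAlgHom K L N) (IsScalarTower.toAlgHom K M N)) →
        ∃ n : ℕ, Nonempty ((N ⊗[L] A) ≃ₐ[N] Matrix (Fin n) (Fin n) N) := by
  obtain ⟨L', hfin, hsep, hcop, n, ⟨e⟩⟩ := hsplit
  have : FiniteDimensional K L := FiniteDimensional.of_finrank_pos (hdeg ▸ hp.pos)
  have : FiniteDimensional K L' := FiniteDimensional.trans K L L'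
  have : Algebra.IsSeparable K L' := Algebra.IsSeparable.trans K L L'
  let E := IntermediateField.normalClosure K L' (AlgebraicClosure K)
  have : IsGalois K E := IntermediateField.isGalois_normalClosure K L' _
  obtain ⟨M, hMfin, hMcop, hME, k, hk⟩ :=
    E.exists_le_coprime_finrank_and_finrank_eq_pow hp
  refine ⟨M, hMfin, hMcop, fun N _ _ _ _ _ _ hsurj ↦ ⟨n, ?_⟩⟩
  suffices Nonempty (L' →ₐ[L] N) from this.elim fun ρ ↦ exists_algEquiv_matrix_of_algHom ρ e
  have : FiniteDimensional K N := Module.Finite.of_surjective _ hsurj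
  have : FiniteDimensional M N := FiniteDimensional.right K M N
  let φ : N →ₐ[M] AlgebraicClosure K := IsAlgClosed.lift
  let : Algebra N (AlgebraicClosure K) := φ.toRingHom.toAlgebra
  let : Algebra L (AlgebraicClosure K) := (φ.toRingHom.comp (algebraMap L N)).toAlgebra
  have : IsScalarTower L N (AlgebraicClosure K) := IsScalarTower.of_algebraMap_eq fun _ ↦ rfl
  have hφ (x : K) : φ (algebraMap K N x) = algebraMap K (AlgebraicClosure K) x :=
    (φ.restrictScalars K).commutes x
  have : IsScalarTower K L (AlgebraicClosure K) := IsScalarTower.of_algebraMap_eq fun x ↦ by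
    rw [← hφ x, IsScalarTower.algebraMap_apply K L N]; rfl
  have hconj (σ : L' →ₐ[K] AlgebraicClosure K) (x : L') : σ x ∈ E :=
    σ.fieldRange_le_normalClosure ⟨x, rfl⟩
  have hL (l : L) : φ (algebraMap L N l) ∈ E := by
    let σ : L' →ₐ[L] AlgebraicClosure K := IsAlgClosed.lift
    have := hconj (σ.restrictScalars K) (algebraMap L L' l)
    rwa [AlgHom.restrictScalars_apply, σ.commutes] at this
  have hNE (x : N) : φ x ∈ E := by
    obtain ⟨t, rfl⟩ := hsurj x
    induction t with
    | zero => simp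
    | add a b ha hb => rw [map_add, map_add]; exact add_mem ha hb
    | tmul l m =>
      rw [Algebra.TensorProduct.productMap_apply_tmul, map_mul]
      refine mul_mem (hL l) ?_
      have : φ (algebraMap M N m) = m := φ.commutes m
      exact this ▸ hME m.2
  let E' : IntermediateField N (AlgebraicClosure K) := E.toSubfield.toIntermediateField hNE
  let : Algebra M E' := (IntermediateField.inclusion hME).toRingHom.toAlgebra
  have : IsScalarTower M N E' := IsScalarTower.of_algebraMap_eq fun x ↦
    Subtype.ext (φ.commutes x).symm
  have hdvd : finrank N E' ∣ p ^ k := by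
    rw [← hk]
    exact ⟨finrank M N, by rw [mul_comm]; exact (finrank_mul_finrank M N E').symm⟩
  obtain ⟨j, -, hj⟩ := (Nat.dvd_prime_pow hp).mp hdvd
  exact nonempty_algHom_of_finrank_eq_pow hp hcop E' hj hconj
end

section
/- Let k be a p-adic field and let E/k be a finite field extension such that every field extension of k of degree p admits a k-embedding into E. Let D be a central division algebra of degree p over E. Then for every prime ℓ there exist a finite field extension L/k of degree coprime to ℓ and a field extension M/L of degree p such that D ⊗_E (M ⊗_k E) is a split algebra, i.e., its base change to each field factor of the étale E-algebra M ⊗_k E is a matrix algebra. -/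
open scoped TensorProduct
open Module

set_option synthInstance.maxHeartbeats 400000
set_option maxHeartbeats 800000

/-- The central simple algebra `D` of degree `p` over `E` is split over `M ⊗_k E`, i.e. its
base change to every field factor `F` of the étale `E`-algebra `M ⊗_k E` is a matrix algebra;
field factors are encoded as fields `F` receiving `M` and `E` compatibly over `k` with the
induced map `M ⊗[k] E → F` surjective. -/
def CSASplitsOver (k E : Type) [Field k] [Field E] [Algebra k E]
    (D : Type) [Ring D] [Algebra E D] (p : ℕ)
    (M : Type) [Field M] [Algebra k M] : Prop :=
  ∀ (F : Type) [Field F] [Algebra k F] [Algebra M F] [Algebra E F]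
    [IsScalarTower k M F] [IsScalarTower k E F],
    Function.Surjective (Algebra.TensorProduct.productMap
      (IsScalarTower.toAlgHom k M F) (IsScalarTower.toAlgHom k E F)) →
    Nonempty ((F ⊗[E] D) ≃ₐ[F] Matrix (Fin p) (Fin p) F)

section NormOnDivisionAlgebra

variable (p : ℕ) [Fact p.Prime]

theorem spectralNorm_pow_finrank (K : Type*) [Field K] [Algebra ℚ_[p] K]
    [FiniteDimensional ℚ_[p] K] (x : K) :
    spectralNorm ℚ_[p] K x ^ finrank ℚ_[p] K = ‖Algebra.norm ℚ_[p] x‖ := by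
  have hx : IsIntegral ℚ_[p] x := Algebra.IsIntegral.isIntegral x
  rw [spectralNorm.spectralNorm_eq_norm_coeff_zero_rpow, Algebra.norm_eq_norm_adjoin,
    ← IntermediateField.adjoin.powerBasis_gen hx,
    Algebra.PowerBasis.norm_gen_eq_coeff_zero_minpoly, norm_pow, norm_mul, norm_pow, norm_neg,
    norm_one, one_pow, one_mul, IntermediateField.adjoin.powerBasis_gen hx,
    IntermediateField.minpoly_gen,
    ← finrank_mul_finrank ℚ_[p] (IntermediateField.adjoin ℚ_[p] {x}) K, pow_mul,
    IntermediateField.adjoin.finrank hx, one_div,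
    Real.rpow_inv_natCast_pow (norm_nonneg _) (minpoly.natDegree_pos hx).ne']

variable {D : Type*} [DivisionRing D] [Algebra ℚ_[p] D] [FiniteDimensional ℚ_[p] D]

/-- The subalgebra generated by one element of a finite-dimensional division algebra is a
field. -/
@[reducible]
noncomputable def adjoinSingletonField {F D : Type*} [Field F] [DivisionRing D] [Algebra F D]
    [FiniteDimensional F D] (x : D) : Field (Algebra.adjoin F {x}) :=
  fieldOfFiniteDimensional F _

/-- The absolute value of an element of a finite-dimensional division algebra over `ℚ_[p]`. -/
noncomputable def divisionNorm (x : D) : ℝ := spectralValue (minpoly ℚ_[p] x)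

theorem divisionNorm_algHom {A B : Type*} [DivisionRing A] [Algebra ℚ_[p] A] [DivisionRing B]
    [Algebra ℚ_[p] B] (f : A →ₐ[ℚ_[p]] B) (x : A) :
    divisionNorm p (f x) = divisionNorm p x := by
  rw [divisionNorm, minpoly.algHom_eq f (RingHom.injective (f : A →+* B)), divisionNorm]

theorem divisionNorm_pow_finrank (x : D) :
    divisionNorm p x ^ finrank ℚ_[p] D = ‖Algebra.norm ℚ_[p] x‖ := by
  let := adjoinSingletonField (F := ℚ_[p]) x
  let K := Algebra.adjoin ℚ_[p] {x}
  let y : K := ⟨x, Algebra.self_mem_adjoin_singleton _ x⟩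
  have h1 : divisionNorm p x = spectralNorm ℚ_[p] K y := by
    rw [spectralNorm, divisionNorm, ← minpoly.algHom_eq K.val Subtype.val_injective y]; rfl
  have h2 : Algebra.norm ℚ_[p] x = Algebra.norm ℚ_[p] y ^ finrank K D := by
    rw [← map_pow, ← mul_one (y ^ _), ← LinearMap.det_id (M := D), ← LinearMap.det_smul,
      ← LinearMap.det_restrictScalars]
    rfl
  rw [h2, norm_pow, ← spectralNorm_pow_finrank, ← h1, ← pow_mul, finrank_mul_finrank]

omit [FiniteDimensional ℚ_[p] D] in
theorem divisionNorm_nonneg (x : D) : 0 ≤ divisionNorm p x := spectralValue_nonneg _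

theorem divisionNorm_mul (x y : D) :
    divisionNorm p (x * y) = divisionNorm p x * divisionNorm p y := by
  refine (pow_left_inj₀ (divisionNorm_nonneg p _) (mul_nonneg (divisionNorm_nonneg p _)
    (divisionNorm_nonneg p _)) (finrank_pos (R := ℚ_[p]) (M := D)).ne').mp ?_
  rw [mul_pow]
  simp only [divisionNorm_pow_finrank, map_mul, norm_mul]

omit [FiniteDimensional ℚ_[p] D] in
theorem divisionNorm_algebraMap (a : ℚ_[p]) :
    divisionNorm p (algebraMap ℚ_[p] D a) = ‖a‖ := by
  rw [divisionNorm, minpoly.eq_X_sub_C, spectralValue_X_sub_C]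

omit [FiniteDimensional ℚ_[p] D] in
theorem divisionNorm_zero : divisionNorm p (0 : D) = 0 := by
  simpa using divisionNorm_algebraMap p (D := D) 0

omit [FiniteDimensional ℚ_[p] D] in
theorem divisionNorm_one : divisionNorm p (1 : D) = 1 := by
  simpa using divisionNorm_algebraMap p (D := D) 1

theorem eq_zero_of_divisionNorm_eq_zero {x : D} (h : divisionNorm p x = 0) : x = 0 := by
  by_contra hx
  have := divisionNorm_mul p x x⁻¹
  rw [mul_inv_cancel₀ hx, divisionNorm_one, h, zero_mul] at this
  exact one_ne_zero this

theorem divisionNorm_one_add_le {x : D} (hx : divisionNorm p x ≤ 1) :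
    divisionNorm p (1 + x) ≤ 1 := by
  let := adjoinSingletonField (F := ℚ_[p]) x
  let K := Algebra.adjoin ℚ_[p] {x}
  let y : K := ⟨x, Algebra.self_mem_adjoin_singleton _ x⟩
  have hy : divisionNorm p y ≤ 1 := by rwa [← divisionNorm_algHom p K.val]
  have h : divisionNorm p (1 + y) ≤ max (divisionNorm p (1 : K)) (divisionNorm p y) :=
    isNonarchimedean_spectralNorm (K := ℚ_[p]) (L := K) 1 y
  rw [← divisionNorm_algHom p K.val, divisionNorm_one] at h
  exact h.trans (max_le le_rfl hy)

theorem divisionNorm_add_le (x y : D) :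
    divisionNorm p (x + y) ≤ max (divisionNorm p x) (divisionNorm p y) := by
  wlog h : divisionNorm p y ≤ divisionNorm p x generalizing x y
  · rw [add_comm, max_comm]; exact this y x (le_of_not_ge h)
  rcases eq_or_ne x 0 with rfl | hx
  · simp
  refine le_max_of_le_left ?_
  have hpos : 0 < divisionNorm p x := (divisionNorm_nonneg p x).lt_of_ne
    fun h => hx (eq_zero_of_divisionNorm_eq_zero p h.symm)
  have hxy : x + y = x * (1 + x⁻¹ * y) := by rw [mul_add, mul_inv_cancel_left₀ hx, mul_one]
  have hle : divisionNorm p (x⁻¹ * y) ≤ 1 := by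
    have h1 : divisionNorm p x * divisionNorm p (x⁻¹ * y) = divisionNorm p y := by
      rw [← divisionNorm_mul, mul_inv_cancel_left₀ hx]
    by_contra hlt
    nlinarith
  rw [hxy, divisionNorm_mul]
  exact mul_le_of_le_one_right hpos.le (divisionNorm_one_add_le p hle)

theorem divisionNorm_neg (x : D) : divisionNorm p (-x) = divisionNorm p x := by
  have h : divisionNorm p (-1 : D) = 1 := by
    rcases mul_self_eq_one_iff.mp (by rw [← divisionNorm_mul, neg_mul_neg, one_mul,
      divisionNorm_one] : divisionNorm p (-1 : D) * divisionNorm p (-1 : D) = 1) with h | h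
    · exact h
    · linarith [divisionNorm_nonneg p (-1 : D)]
  rw [← neg_one_mul, divisionNorm_mul, h, one_mul]

variable (D) in
/-- The absolute value of a finite-dimensional division algebra over `ℚ_[p]` as a ring norm. -/
noncomputable def divisionRingNorm : RingNorm D where
  toFun := divisionNorm p
  map_zero' := divisionNorm_zero p
  add_le' x y := (divisionNorm_add_le p x y).trans
    (max_le_add_of_nonneg (divisionNorm_nonneg p _) (divisionNorm_nonneg p _))
  neg' := divisionNorm_neg p
  mul_le' x y := (divisionNorm_mul p x y).le
  eq_zero_of_map_eq_zero' _ := eq_zero_of_divisionNorm_eq_zero p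

theorem divisionRingNorm_mul (x y : D) :
    divisionRingNorm p D (x * y) = divisionRingNorm p D x * divisionRingNorm p D y :=
  divisionNorm_mul p x y

variable (D) in
/-- A finite-dimensional division algebra over `ℚ_[p]` as a normed division ring. -/
@[reducible]
noncomputable def padicNormedDivisionRing : NormedDivisionRing D :=
  let R := (divisionRingNorm p D).toNormedRing
  { ‹DivisionRing D› with
    norm := R.norm
    toMetricSpace := R.toMetricSpace
    dist_eq := by
      intro x y
      exact R.dist_eq x y
    norm_mul := by
      intro x y
      exact divisionRingNorm_mul (D := D) p x y }

/-- A finite extension of `ℚ_[p]` as a normed field. -/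
@[reducible]
noncomputable def padicNormedField (K : Type*) [Field K] [Algebra ℚ_[p] K]
    [FiniteDimensional ℚ_[p] K] : NormedField K :=
  { ‹Field K›, padicNormedDivisionRing p K with }

/-- The normed algebra structure carried by `padicNormedDivisionRing`. -/
@[reducible]
noncomputable def padicNormedAlgebra (D : Type*) [DivisionRing D] [Algebra ℚ_[p] D]
    [FiniteDimensional ℚ_[p] D] :
    @NormedAlgebra ℚ_[p] D _ (padicNormedDivisionRing p D).toNormedRing.toSeminormedRing :=
  let := padicNormedDivisionRing p D
  { ‹Algebra ℚ_[p] D› with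
    norm_smul_le := fun a x => by
      rw [Algebra.smul_def, norm_mul]
      exact (congrArg (· * ‖x‖) (divisionNorm_algebraMap p a)).le }

theorem padic_isUltrametricDist (D : Type*) [DivisionRing D] [Algebra ℚ_[p] D]
    [FiniteDimensional ℚ_[p] D] :
    @IsUltrametricDist D (padicNormedDivisionRing p D).toDist :=
  let := padicNormedDivisionRing p D
  IsUltrametricDist.isUltrametricDist_of_forall_norm_add_le_max_norm (divisionNorm_add_le p)

end NormOnDivisionAlgebra

section UltrametricDivisionAlgebra

variable {p : ℕ} [Fact p.Prime] {D : Type*} [NormedDivisionRing D] [NormedAlgebra ℚ_[p] D]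
  [IsUltrametricDist D]

theorem norm_prime_lt_one (p : ℕ) [Fact p.Prime] (D : Type*) [NormedDivisionRing D]
    [NormedAlgebra ℚ_[p] D] : ‖(p : D)‖ < 1 := by
  rw [← map_natCast (algebraMap ℚ_[p] D), norm_algebraMap']
  exact Padic.norm_p_lt_one

theorem norm_prime_pos (p : ℕ) [Fact p.Prime] (D : Type*) [NormedDivisionRing D]
    [NormedAlgebra ℚ_[p] D] : 0 < ‖(p : D)‖ := by
  rw [← map_natCast (algebraMap ℚ_[p] D), norm_algebraMap', Padic.norm_p]
  exact inv_pos.mpr (Nat.cast_pos.mpr (Fact.out : p.Prime).pos)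

theorem norm_natCast_eq_one_of_not_dvd (p : ℕ) [Fact p.Prime] (D : Type*) [NormedDivisionRing D]
    [NormedAlgebra ℚ_[p] D] {m : ℕ} (hm : ¬ p ∣ m) : ‖(m : D)‖ = 1 := by
  rw [← map_natCast (algebraMap ℚ_[p] D), norm_algebraMap', Padic.norm_natCast_eq_one_iff]
  exact (Nat.Prime.coprime_iff_not_dvd Fact.out).mpr hm

section Metric

variable {A : Type*} [NormedDivisionRing A] [IsUltrametricDist A]

theorem norm_sub_le_max (x y : A) : ‖x - y‖ ≤ max ‖x‖ ‖y‖ := by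
  rw [sub_eq_add_neg, ← norm_neg y]
  exact IsUltrametricDist.norm_add_le_max _ _

theorem norm_sub_le_max_sub (x y z : A) : ‖x - z‖ ≤ max ‖x - y‖ ‖y - z‖ := by
  rw [← sub_add_sub_cancel x y z]
  exact IsUltrametricDist.norm_add_le_max _ _

theorem norm_eq_of_norm_sub_lt {x y : A} (h : ‖x - y‖ < ‖y‖) : ‖x‖ = ‖y‖ := by
  refine le_antisymm ?_ ?_
  · calc ‖x‖ = ‖(x - y) + y‖ := by rw [sub_add_cancel]
      _ ≤ max ‖x - y‖ ‖y‖ := IsUltrametricDist.norm_add_le_max _ _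
      _ ≤ ‖y‖ := max_le h.le le_rfl
  · by_contra! hlt
    have := norm_sub_le_max x (x - y)
    rw [sub_sub_cancel] at this
    exact absurd (this.trans_lt (max_lt hlt h)) (lt_irrefl _)

theorem norm_pow_sub_pow_le {a b : A} (h : Commute a b) (ha : ‖a‖ ≤ 1) (hb : ‖b‖ ≤ 1) (n : ℕ) :
    ‖a ^ n - b ^ n‖ ≤ ‖a - b‖ := by
  rw [← h.mul_geom_sum₂, norm_mul]
  refine mul_le_of_le_one_right (norm_nonneg _) ?_
  refine IsUltrametricDist.norm_sum_le_of_forall_le_of_nonneg zero_le_one fun i _ => ?_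
  rw [norm_mul, norm_pow, norm_pow]
  exact mul_le_one₀ (pow_le_one₀ (norm_nonneg _) ha) (by positivity)
    (pow_le_one₀ (norm_nonneg _) hb)

end Metric

theorem norm_pow_prime_sub_pow_prime_lt {a b : D} (h : Commute a b) (ha : ‖a‖ ≤ 1)
    (hb : ‖b‖ ≤ 1) (hab : ‖a - b‖ < 1) (hne : a ≠ b) : ‖a ^ p - b ^ p‖ < ‖a - b‖ := by
  rw [← h.mul_geom_sum₂, norm_mul]
  refine mul_lt_of_lt_one_right (norm_pos_iff.mpr (sub_ne_zero.mpr hne)) ?_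
  have h1 : ‖∑ i ∈ Finset.range p, (a ^ i * b ^ (p - 1 - i) - b ^ (p - 1))‖ ≤ ‖a - b‖ := by
    refine IsUltrametricDist.norm_sum_le_of_forall_le_of_nonneg (norm_nonneg _) fun i hi => ?_
    have : b ^ (p - 1) = b ^ i * b ^ (p - 1 - i) := by
      rw [← pow_add, Nat.add_sub_cancel' (Nat.le_sub_one_of_lt (Finset.mem_range.mp hi))]
    rw [this, ← sub_mul, norm_mul, norm_pow]
    exact (mul_le_of_le_one_right (norm_nonneg _) (pow_le_one₀ (norm_nonneg _) hb)).trans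
      (norm_pow_sub_pow_le h ha hb i)
  rw [Finset.sum_sub_distrib, Finset.sum_const, Finset.card_range, nsmul_eq_mul] at h1
  have h2 : ‖(p : D) * b ^ (p - 1)‖ < 1 := by
    rw [norm_mul, norm_pow]
    exact (mul_le_of_le_one_right (norm_nonneg _) (pow_le_one₀ (norm_nonneg _) hb)).trans_lt
      (norm_prime_lt_one p D)
  have h3 := IsUltrametricDist.norm_add_le_max
    (∑ i ∈ Finset.range p, a ^ i * b ^ (p - 1 - i) - (p : D) * b ^ (p - 1))
    ((p : D) * b ^ (p - 1))
  rw [sub_add_cancel] at h3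
  exact h3.trans_lt (max_lt (h1.trans_lt hab) h2)

theorem norm_pow_primePow_sub_lt {a b : D} (h : Commute a b) (ha : ‖a‖ ≤ 1)
    (hb : ‖b‖ ≤ 1) (hab : ‖a - b‖ < 1) (hne : a ≠ b) {s : ℕ} (hs : s ≠ 0) :
    ‖a ^ p ^ s - b ^ p ^ s‖ < ‖a - b‖ := by
  obtain ⟨s, rfl⟩ := Nat.exists_eq_succ_of_ne_zero hs
  rw [pow_succ', pow_mul, pow_mul]
  refine (norm_pow_sub_pow_le (h.pow_pow p p) ?_ ?_ _).trans_lt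
    (norm_pow_prime_sub_pow_prime_lt h ha hb hab hne)
  · rw [norm_pow]; exact pow_le_one₀ (norm_nonneg _) ha
  · rw [norm_pow]; exact pow_le_one₀ (norm_nonneg _) hb

theorem norm_sub_lt_one_of_norm_pow_prime_sub_lt_one {a b : D} (h : Commute a b) (ha : ‖a‖ ≤ 1)
    (hb : ‖b‖ ≤ 1) (hab : ‖a ^ p - b ^ p‖ < 1) : ‖a - b‖ < 1 := by
  have hc : Commute (a - b) b := h.sub_left (Commute.refl b)
  have key := hc.add_pow_prime_eq (Fact.out : p.Prime)
  rw [sub_add_cancel] at key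
  have hsub : ‖a - b‖ ≤ 1 := (norm_sub_le_max a b).trans (max_le ha hb)
  have h1 : ‖∑ k ∈ Finset.Ioo 0 p,
      (a - b) ^ (k - 1) * b ^ (p - k - 1) * ((p.choose k / p : ℕ) : D)‖ ≤ 1 := by
    refine IsUltrametricDist.norm_sum_le_of_forall_le_of_nonneg zero_le_one fun k _ => ?_
    rw [norm_mul, norm_mul, norm_pow, norm_pow]
    exact mul_le_one₀ (mul_le_one₀ (pow_le_one₀ (norm_nonneg _) hsub) (by positivity)
      (pow_le_one₀ (norm_nonneg _) hb)) (norm_nonneg _) (IsUltrametricDist.norm_natCast_le_one D _)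
  have h3 : ‖(a - b) ^ p‖ < 1 := by
    rw [← add_sub_cancel_right ((a - b) ^ p) (b ^ p), ← add_sub_cancel_right (_ + _) (_ * _),
      ← key, sub_right_comm]
    refine (norm_sub_le_max _ _).trans_lt (max_lt hab ?_)
    rw [norm_mul, norm_mul, norm_mul, mul_assoc, mul_assoc]
    exact (mul_le_of_le_one_right (norm_nonneg _) (mul_le_one₀ hsub (by positivity)
      (mul_le_one₀ hb (norm_nonneg _) h1))).trans_lt (norm_prime_lt_one p D)
  rw [norm_pow] at h3
  by_contra! hle
  exact absurd h3 (not_lt.mpr (one_le_pow₀ hle))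

theorem norm_sub_lt_one_of_norm_pow_primePow_sub_lt_one {a b : D} (h : Commute a b)
    (ha : ‖a‖ ≤ 1) (hb : ‖b‖ ≤ 1) {s : ℕ} (hab : ‖a ^ p ^ s - b ^ p ^ s‖ < 1) : ‖a - b‖ < 1 := by
  induction s with
  | zero => simpa using hab
  | succ s ih =>
    rw [pow_succ, pow_mul, pow_mul] at hab
    refine ih (norm_sub_lt_one_of_norm_pow_prime_sub_lt_one (h.pow_pow _ _) ?_ ?_ hab)
    · rw [norm_pow]; exact pow_le_one₀ (norm_nonneg _) ha
    · rw [norm_pow]; exact pow_le_one₀ (norm_nonneg _) hb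

/-- Rigidity of Teichmüller representatives. -/
theorem eq_of_pow_primePow_eq {z w : D} (h : Commute z w) {s : ℕ} (hs : s ≠ 0)
    (hz : z ^ p ^ s = z) (hw : w ^ p ^ s = w) (hz1 : ‖z‖ ≤ 1) (hw1 : ‖w‖ ≤ 1)
    (hzw : ‖z - w‖ < 1) : z = w := by
  by_contra hne
  have := norm_pow_primePow_sub_lt (p := p) h hz1 hw1 hzw hne hs
  rw [hz, hw] at this
  exact lt_irrefl _ this

variable [FiniteDimensional ℚ_[p] D]

theorem properSpace_of_finiteDimensional_padic (p : ℕ) [Fact p.Prime] (D : Type*)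
    [NormedDivisionRing D] [NormedAlgebra ℚ_[p] D] [FiniteDimensional ℚ_[p] D] : ProperSpace D :=
  FiniteDimensional.proper ℚ_[p] D

variable (p) in
theorem exists_norm_pow_primePow_sub_lt_one {x : D} (hx : ‖x‖ ≤ 1) :
    ∃ s : ℕ, s ≠ 0 ∧ ‖x ^ p ^ s - x‖ < 1 := by
  have := properSpace_of_finiteDimensional_padic p D
  have hmem : ∀ n : ℕ, x ^ p ^ n ∈ Metric.closedBall (0 : D) 1 := fun n => by
    rw [mem_closedBall_zero_iff, norm_pow]
    exact pow_le_one₀ (norm_nonneg _) hx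
  obtain ⟨a, -, φ, hφ, ha⟩ := (isCompact_closedBall (0 : D) 1).tendsto_subseq hmem
  obtain ⟨N, hN⟩ := Metric.cauchySeq_iff.mp ha.cauchySeq 1 one_pos
  have h1 := hN (N + 1) (Nat.le_succ N) N le_rfl
  have hlt : φ N < φ (N + 1) := hφ (Nat.lt_succ_self N)
  refine ⟨φ (N + 1) - φ N, (Nat.sub_pos_of_lt hlt).ne', ?_⟩
  refine norm_sub_lt_one_of_norm_pow_primePow_sub_lt_one (p := p) (s := φ N)
    (Commute.pow_left (Commute.refl x) _) ?_ hx ?_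
  · rw [norm_pow]; exact pow_le_one₀ (norm_nonneg _) hx
  · rw [← pow_mul, ← pow_add, Nat.sub_add_cancel hlt.le]
    simpa [dist_eq_norm] using h1

theorem exists_teichmuller {x : D} (hx : ‖x‖ ≤ 1) {s : ℕ} (hs : s ≠ 0)
    (hxs : ‖x ^ p ^ s - x‖ < 1) : ∃ z : D, z ^ p ^ s = z ∧ ‖z - x‖ < 1 := by
  have := properSpace_of_finiteDimensional_padic p D
  set δ := ‖x ^ p ^ s - x‖ with hδ
  let T : Set D := Metric.closedBall 0 1 ∩ ({y | ‖y - x‖ ≤ δ} ∩ {y | x * y = y * x})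
  have hT : IsCompact T := (isCompact_closedBall (0 : D) 1).inter_right
    ((isClosed_le (by fun_prop) continuous_const).inter
      (isClosed_eq (by fun_prop) (by fun_prop)))
  obtain ⟨y, ⟨hy1, hy2, hy3⟩, hmin⟩ := hT.exists_isMinOn
    (⟨x, by simpa using hx, by simp [hδ], rfl⟩ : T.Nonempty)
    (f := fun y => ‖y ^ p ^ s - y‖) (by fun_prop)
  rw [mem_closedBall_zero_iff] at hy1
  rw [Set.mem_ofPred_eq] at hy2 hy3
  refine ⟨y, ?_, hy2.trans_lt hxs⟩
  by_contra hne
  have hc : Commute x y := hy3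
  have hyx : ‖y ^ p ^ s - x ^ p ^ s‖ ≤ ‖y - x‖ := norm_pow_sub_pow_le hc.symm hy1 hx _
  have h1 : ‖y ^ p ^ s - x‖ ≤ δ :=
    (norm_sub_le_max_sub _ (x ^ p ^ s) _).trans (max_le (hyx.trans hy2) le_rfl)
  have h2 : ‖y ^ p ^ s - y‖ < 1 :=
    (norm_sub_le_max_sub _ x _).trans_lt (max_lt (h1.trans_lt hxs)
      (by rw [norm_sub_rev]; exact hy2.trans_lt hxs))
  have hys : ‖y ^ p ^ s‖ ≤ 1 := by rw [norm_pow]; exact pow_le_one₀ (norm_nonneg _) hy1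
  have h3 := norm_pow_primePow_sub_lt (p := p) (Commute.pow_left (Commute.refl y) (p ^ s))
    hys hy1 h2 hne hs
  exact absurd (hmin ⟨by simpa using hys, h1, (hc.pow_right (p ^ s)).eq⟩) (not_le.mpr h3)

theorem subalgebra_eq_top_of_approx (S : Subalgebra ℚ_[p] D)
    (h1 : ∀ x : D, x ≠ 0 → ∃ s ∈ S, ‖s‖ = ‖x‖)
    (h2 : ∀ u : D, ‖u‖ = 1 → ∃ e ∈ S, ‖e - u‖ < 1) : S = ⊤ := by
  have := properSpace_of_finiteDimensional_padic p D
  have hcl : IsClosed (S : Set D) := Submodule.closed_of_finiteDimensional S.toSubmodule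
  refine eq_top_iff.mpr fun x _ => ?_
  obtain ⟨y, hy, hxy⟩ := hcl.exists_infDist_eq_dist ⟨0, S.zero_mem⟩ x
  by_contra hx
  have hne : x - y ≠ 0 := sub_ne_zero.mpr fun h => hx (h ▸ hy)
  obtain ⟨s, hs, hsn⟩ := h1 _ hne
  have hs0 : s ≠ 0 := by rw [← norm_pos_iff, hsn, norm_pos_iff]; exact hne
  obtain ⟨e, he, hen⟩ := h2 ((x - y) * s⁻¹) (by
    rw [norm_mul, norm_inv, hsn, mul_inv_cancel₀ (norm_ne_zero_iff.mpr hne)])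
  have h3 : ‖x - (y + e * s)‖ < ‖x - y‖ := by
    have : x - (y + e * s) = -((e - (x - y) * s⁻¹) * s) := by
      rw [sub_mul, inv_mul_cancel_right₀ hs0]; abel
    rw [this, norm_neg, norm_mul, hsn]
    exact mul_lt_of_lt_one_left (norm_pos_iff.mpr hne) hen
  have h4 := Metric.infDist_le_dist_of_mem (x := x) (S.add_mem hy (S.mul_mem he hs))
  rw [hxy, dist_eq_norm, dist_eq_norm] at h4
  exact absurd h3 (not_lt.mpr h4)

theorem exists_uniformizer (p : ℕ) [Fact p.Prime] (D : Type*)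
    [NormedDivisionRing D] [NormedAlgebra ℚ_[p] D] [IsUltrametricDist D]
    [FiniteDimensional ℚ_[p] D] : ∃ ϖ : D, ϖ ≠ 0 ∧ ‖ϖ‖ < 1 ∧ (∀ x : D, ‖x‖ < 1 → ‖x‖ ≤ ‖ϖ‖) ∧
    ∀ x : D, x ≠ 0 → ∃ j : ℤ, ‖x‖ = ‖ϖ‖ ^ j := by
  have := properSpace_of_finiteDimensional_padic p D
  have hK : IsCompact (Metric.ball (0 : D) 1) :=
    (isCompact_closedBall (0 : D) 1).of_isClosed_subset
      (IsUltrametricDist.isClosed_ball 0 1) Metric.ball_subset_closedBall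
  obtain ⟨ϖ, hϖ, hmax⟩ := hK.exists_isMaxOn (Metric.nonempty_ball.mpr one_pos)
    continuous_norm.continuousOn
  rw [mem_ball_zero_iff] at hϖ
  have hmax' : ∀ x : D, ‖x‖ < 1 → ‖x‖ ≤ ‖ϖ‖ := fun x hx => hmax (by simpa using hx)
  have hpos : 0 < ‖ϖ‖ := (norm_prime_pos p D).trans_le (hmax' _ (norm_prime_lt_one p D))
  have hne := norm_pos_iff.mp hpos
  refine ⟨ϖ, hne, hϖ, hmax', fun x hx => ?_⟩
  obtain ⟨n, hn1, hn2⟩ := exists_mem_Ioc_zpow (norm_pos_iff.mpr hx)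
    ((one_lt_inv₀ hpos).mpr hϖ)
  refine ⟨-(n + 1), ?_⟩
  rw [inv_zpow', ← norm_zpow] at hn1 hn2
  rw [← norm_zpow]
  have hz : ϖ ^ (-(n + 1)) ≠ 0 := zpow_ne_zero _ hne
  have h1 : ‖x * (ϖ ^ (-(n + 1)))⁻¹‖ ≤ 1 := by
    rw [norm_mul, norm_inv, ← div_eq_mul_inv]
    exact div_le_one_of_le₀ hn2 (norm_nonneg _)
  have h2 : ‖ϖ‖ < ‖x * (ϖ ^ (-(n + 1)))⁻¹‖ := by
    rw [norm_mul, norm_inv, ← div_eq_mul_inv, lt_div_iff₀ (norm_pos_iff.mpr hz), ← norm_mul,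
      ← zpow_one_add₀ hne]
    rwa [show 1 + -(n + 1) = -n by ring]
  rcases h1.lt_or_eq with h1 | h1
  · exact absurd (hmax' _ h1) (not_le.mpr h2)
  · rw [norm_mul, norm_inv, ← div_eq_mul_inv, div_eq_one_iff_eq (norm_ne_zero_iff.mpr hz)] at h1
    exact h1

theorem exists_teichmuller_notMem_center (hD : ∃ x y : D, x * y ≠ y * x) :
    ∃ (z y : D) (s : ℕ), s ≠ 0 ∧ z ^ p ^ s = z ∧ z * y ≠ y * z := by
  by_contra! hcon
  obtain ⟨ϖ, hϖ0, -, -, hϖ⟩ := exists_uniformizer p D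
  have approx : ∀ u : D, ‖u‖ = 1 → ∃ z : D, (∀ y, z * y = y * z) ∧ ‖z - u‖ < 1 := fun u hu => by
    obtain ⟨s, hs, hus⟩ := exists_norm_pow_primePow_sub_lt_one p hu.le
    obtain ⟨z, hz, hzu⟩ := exists_teichmuller hu.le hs hus
    exact ⟨z, fun y => hcon z y s hs hz, hzu⟩
  have h1 : Subalgebra.centralizer ℚ_[p] {ϖ} = ⊤ := by
    refine subalgebra_eq_top_of_approx _ (fun x hx => ?_) fun u hu => ?_
    · obtain ⟨j, hj⟩ := hϖ x hx
      refine ⟨ϖ ^ j, ?_, by rw [norm_zpow, hj]⟩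
      rw [Subalgebra.mem_centralizer_iff]
      rintro _ rfl
      exact ((Commute.refl _).zpow_right₀ j).eq
    · obtain ⟨z, hz, hzu⟩ := approx u hu
      refine ⟨z, ?_, hzu⟩
      rw [Subalgebra.mem_centralizer_iff]
      rintro _ rfl
      exact (hz _).symm
  have hcϖ : ∀ y, Commute ϖ y := fun y => by
    have hy : y ∈ Subalgebra.centralizer ℚ_[p] {ϖ} := h1 ▸ Algebra.mem_top
    exact (Subalgebra.mem_centralizer_iff _).mp hy ϖ rfl
  have h2 : Subalgebra.center ℚ_[p] D = ⊤ := by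
    refine subalgebra_eq_top_of_approx _ (fun x hx => ?_) fun u hu => ?_
    · obtain ⟨j, hj⟩ := hϖ x hx
      refine ⟨ϖ ^ j, ?_, by rw [norm_zpow, hj]⟩
      rw [Subalgebra.mem_center_iff]
      exact fun y => ((hcϖ y).zpow_left₀ j).symm.eq
    · obtain ⟨z, hz, hzu⟩ := approx u hu
      exact ⟨z, Subalgebra.mem_center_iff.mpr fun y => (hz y).symm, hzu⟩
  obtain ⟨x, y, hxy⟩ := hD
  have hx : x ∈ Subalgebra.center ℚ_[p] D := h2 ▸ Algebra.mem_top
  exact hxy (Subalgebra.mem_center_iff.mp hx y).symm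

end UltrametricDivisionAlgebra

section CyclicNorm

theorem norm_prod_one_add_sub_le {A : Type*} [NormedField A] [IsUltrametricDist A] {ι : Type*}
    (s : Finset ι) (x : ι → A) {c : ℝ} (hc : 0 ≤ c) (hc1 : c ≤ 1) (hx : ∀ i ∈ s, ‖x i‖ ≤ c) :
    ‖∏ i ∈ s, (1 + x i) - 1 - ∑ i ∈ s, x i‖ ≤ c ^ 2 := by
  classical
  induction s using Finset.induction_on with
  | empty => simpa using sq_nonneg c
  | insert a s ha ih =>
    have ih := ih fun i hi => hx i (Finset.mem_insert_of_mem hi)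
    have hxa := hx a (Finset.mem_insert_self a s)
    have hS : ‖∑ i ∈ s, x i‖ ≤ c := IsUltrametricDist.norm_sum_le_of_forall_le_of_nonneg hc
      fun i hi => hx i (Finset.mem_insert_of_mem hi)
    rw [Finset.prod_insert ha, Finset.sum_insert ha]
    set P := ∏ i ∈ s, (1 + x i)
    set S := ∑ i ∈ s, x i
    have : (1 + x a) * P - 1 - (x a + S) = (P - 1 - S) + (x a * S + x a * (P - 1 - S)) := by ring
    rw [this]
    refine (IsUltrametricDist.norm_add_le_max _ _).trans (max_le ih
      ((IsUltrametricDist.norm_add_le_max _ _).trans (max_le ?_ ?_)))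
    · rw [norm_mul, sq]
      gcongr
    · rw [norm_mul]
      calc ‖x a‖ * ‖P - 1 - S‖ ≤ 1 * c ^ 2 := by gcongr; exact hxa.trans hc1
        _ = c ^ 2 := one_mul _

section Iterates

variable {K : Type*} [Field K] (σ : K →+* K)

theorem pow_succ_apply_ringHom (i : ℕ) (w : K) : (σ ^ (i + 1)) w = σ ((σ ^ i) w) := by
  rw [pow_succ']; rfl

theorem map_prod_pow_of_pow_eq_one {p : ℕ} (hp : σ ^ p = 1) {w : K} (hw : w ≠ 0) :
    σ (∏ i ∈ Finset.range p, (σ ^ i) w) = ∏ i ∈ Finset.range p, (σ ^ i) w := by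
  have h1 := Finset.prod_range_succ' (fun i => (σ ^ i) w) p
  rw [Finset.prod_range_succ, hp, pow_zero] at h1
  rw [map_prod]
  simp only [← pow_succ_apply_ringHom]
  exact (mul_right_cancel₀ hw h1).symm

theorem map_sum_pow_of_pow_eq_one {p : ℕ} (hp : σ ^ p = 1) (w : K) :
    σ (∑ i ∈ Finset.range p, (σ ^ i) w) = ∑ i ∈ Finset.range p, (σ ^ i) w := by
  have h1 := Finset.sum_range_succ' (fun i => (σ ^ i) w) p
  rw [Finset.sum_range_succ, hp, pow_zero] at h1
  rw [map_sum]
  simp only [← pow_succ_apply_ringHom]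
  exact (add_right_cancel h1).symm

theorem pow_apply_of_fixed {u : K} (hu : σ u = u) (i : ℕ) : (σ ^ i) u = u := by
  rw [RingHom.coe_pow]
  exact Function.iterate_fixed hu i

theorem pow_apply_ne_of_coprime {p : ℕ} [Fact p.Prime] (hp : σ ^ p = 1) {z : K}
    (hz : σ z ≠ z) {i : ℕ} (hi : ¬ p ∣ i) :
    (σ ^ i) z ≠ z := by
  intro h
  have h1 : Function.IsPeriodicPt σ i z := by rwa [RingHom.coe_pow] at h
  have h2 : Function.IsPeriodicPt σ p z := by
    have : (σ ^ p) z = z := by rw [hp]; rfl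
    rwa [RingHom.coe_pow] at this
  have h3 := h1.gcd h2
  rw [(Nat.coprime_comm.mp ((Nat.Prime.coprime_iff_not_dvd Fact.out).mpr hi)).gcd_eq_one] at h3
  exact hz h3

end Iterates

theorem norm_pow_ringHom_apply {K : Type*} [NormedField K] (σ : K →+* K)
    (hσ : ∀ x, ‖σ x‖ = ‖x‖) (i : ℕ) (x : K) : ‖(σ ^ i) x‖ = ‖x‖ := by
  induction i with
  | zero => rfl
  | succ i ih => rw [pow_succ_apply_ringHom, hσ, ih]

variable {p : ℕ} [Fact p.Prime] {K : Type*} [NormedField K] [NormedAlgebra ℚ_[p] K]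
  [IsUltrametricDist K] (σ : K →+* K)

theorem exists_norm_trace_pow_eq_one (hσ : ∀ x, ‖σ x‖ = ‖x‖) (hp : σ ^ p = 1) {z : K} {m : ℕ}
    (hm : ¬ p ∣ m) (hzm : z ^ m = 1) (hz : σ z ≠ z) :
    ∃ j, ‖∑ i ∈ Finset.range p, (σ ^ i) (z ^ j)‖ = 1 := by
  have hm0 : m ≠ 0 := fun h => hm (h ▸ dvd_zero p)
  have hz0 : z ≠ 0 := fun h => by simp [h, hm0] at hzm
  have hzn : ‖z‖ = 1 := by
    rw [← pow_eq_one_iff_of_nonneg (norm_nonneg z) hm0, ← norm_pow, hzm, norm_one]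
  have hle : ∀ j, ‖∑ i ∈ Finset.range p, (σ ^ i) (z ^ j)‖ ≤ 1 := fun j =>
    IsUltrametricDist.norm_sum_le_of_forall_le_of_nonneg zero_le_one fun i _ => by
      rw [norm_pow_ringHom_apply σ hσ, norm_pow, hzn, one_pow]
  by_contra! hne
  have key : ∑ j ∈ Finset.range m, (z ^ j)⁻¹ * ∑ i ∈ Finset.range p, (σ ^ i) (z ^ j) = m := by
    simp only [Finset.mul_sum]
    rw [Finset.sum_comm, Finset.sum_eq_single_of_mem 0
      (Finset.mem_range.mpr (Fact.out : p.Prime).pos)]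
    · simp [hz0]
    · intro i hi hi0
      have hne : (σ ^ i) z * z⁻¹ ≠ 1 := fun h =>
        pow_apply_ne_of_coprime σ hp hz (Nat.not_dvd_of_pos_of_lt (Nat.pos_of_ne_zero hi0)
          (Finset.mem_range.mp hi)) ((mul_inv_eq_one₀ hz0).mp h)
      have h1 : ∀ j, (z ^ j)⁻¹ * (σ ^ i) (z ^ j) = ((σ ^ i) z * z⁻¹) ^ j := fun j => by
        rw [map_pow, mul_pow, inv_pow, mul_comm]
      simp only [h1]
      have h2 := geom_sum_mul ((σ ^ i) z * z⁻¹) m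
      rw [mul_pow, inv_pow, ← map_pow, hzm, map_one, inv_one, one_mul, sub_self] at h2
      exact (mul_eq_zero.mp h2).resolve_right (sub_ne_zero.mpr hne)
  obtain ⟨j, hj⟩ := IsUltrametricDist.exists_norm_finsetSum_le (Finset.range m)
    (fun j => (z ^ j)⁻¹ * ∑ i ∈ Finset.range p, (σ ^ i) (z ^ j))
  rw [key, norm_natCast_eq_one_of_not_dvd p K hm, norm_mul, norm_inv, norm_pow, hzn, one_pow,
    inv_one, one_mul] at hj
  exact absurd (hj.2.trans_lt ((hle j).lt_of_ne (hne j))) (lt_irrefl _)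

/-- A unit fixed by an automorphism of order `p` moving a root of unity of order prime to `p` is
a norm. -/
theorem exists_prod_pow_eq_of_norm_eq_one [FiniteDimensional ℚ_[p] K]
    (hσ : ∀ x, ‖σ x‖ = ‖x‖) (hp : σ ^ p = 1) {z : K} {m : ℕ}
    (hm : ¬ p ∣ m) (hzm : z ^ m = 1) (hz : σ z ≠ z) {u : K} (hu : σ u = u) (hu1 : ‖u‖ = 1) :
    ∃ w : K, ∏ i ∈ Finset.range p, (σ ^ i) w = u := by
  have := properSpace_of_finiteDimensional_padic p K
  obtain ⟨j, hj⟩ := exists_norm_trace_pow_eq_one σ hσ hp hm hzm hz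
  set t := ∑ i ∈ Finset.range p, (σ ^ i) (z ^ j) with ht
  have ht0 : t ≠ 0 := norm_ne_zero_iff.mp (by rw [hj]; exact one_ne_zero)
  have hm0 : m ≠ 0 := fun h => hm (h ▸ dvd_zero p)
  have hzn : ‖z‖ = 1 := by
    rw [← pow_eq_one_iff_of_nonneg (norm_nonneg z) hm0, ← norm_pow, hzm, norm_one]
  have hσt : ∀ i, (σ ^ i) t = t :=
    pow_apply_of_fixed σ (by rw [ht]; exact map_sum_pow_of_pow_eq_one σ hp _)
  let τ := z ^ j * t⁻¹
  have hτ1 : ‖τ‖ = 1 := by rw [norm_mul, norm_pow, hzn, norm_inv, hj]; simp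
  have hτ : ∑ i ∈ Finset.range p, (σ ^ i) τ = 1 := by
    simp only [τ, map_mul, map_inv₀, hσt]
    rw [← Finset.sum_mul, ← ht, mul_inv_cancel₀ ht0]
  let N : K → K := fun w => ∏ i ∈ Finset.range p, (σ ^ i) w
  have hNmul : ∀ a b, N (a * b) = N a * N b := fun a b => by
    simp only [N, map_mul, Finset.prod_mul_distrib]
  have hNnorm : ∀ w, ‖w‖ = 1 → ‖N w‖ = 1 := fun w hw => by
    simp only [N, norm_prod, norm_pow_ringHom_apply σ hσ, hw, Finset.prod_const_one]
  have hσc : ∀ i, Continuous ⇑(σ ^ i) := fun i =>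
    (AddMonoidHomClass.isometry_of_norm (σ ^ i) (norm_pow_ringHom_apply σ hσ i)).continuous
  have hNc : Continuous N := continuous_finsetProd _ fun i _ => hσc i
  obtain ⟨s, hs, hus⟩ := exists_norm_pow_primePow_sub_lt_one p hu1.le
  obtain ⟨s, rfl⟩ := Nat.exists_eq_succ_of_ne_zero hs
  have hstart : ‖N (u ^ p ^ s) - u‖ < 1 := by
    simpa only [N, map_pow, pow_apply_of_fixed σ hu, Finset.prod_const, Finset.card_range,
      ← pow_mul, ← pow_succ] using hus
  have hstart1 : ‖u ^ p ^ s‖ = 1 := by rw [norm_pow, hu1, one_pow]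
  obtain ⟨w, hw, hmin⟩ := (isCompact_sphere (0 : K) 1).exists_isMinOn
    ⟨u ^ p ^ s, by simpa using hstart1⟩ (f := fun w => ‖N w - u‖) (by fun_prop)
  rw [mem_sphere_zero_iff_norm] at hw
  refine ⟨w, ?_⟩
  by_contra hne
  set e := N w - u with he
  have he0 : e ≠ 0 := sub_ne_zero.mpr hne
  have he1 : ‖e‖ < 1 := (hmin (show u ^ p ^ s ∈ Metric.sphere (0 : K) 1 by
    simpa using hstart1)).trans_lt hstart
  have hw0 : w ≠ 0 := norm_ne_zero_iff.mp (by rw [hw]; exact one_ne_zero)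
  have hNw0 : N w ≠ 0 := norm_ne_zero_iff.mp (by rw [hNnorm w hw]; exact one_ne_zero)
  let η := -(e / N w)
  have hη : ‖η‖ = ‖e‖ := by rw [norm_neg, norm_div, hNnorm w hw, div_one]
  have hση : ∀ i, (σ ^ i) η = η := pow_apply_of_fixed σ (by
    simp only [η, e, N, map_neg, map_div₀, map_sub, hu, map_prod_pow_of_pow_eq_one σ hp hw0])
  have h1 : ‖N (1 + η * τ) - 1 - η‖ ≤ ‖e‖ ^ 2 := by
    have := norm_prod_one_add_sub_le (Finset.range p) (fun i => (σ ^ i) (η * τ))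
      (norm_nonneg e) he1.le (fun i _ => by
        rw [norm_pow_ringHom_apply σ hσ, norm_mul, hτ1, mul_one, hη])
    simpa only [N, map_add, map_one, map_mul, hση, ← Finset.mul_sum, hτ, mul_one] using this
  have hητ : ‖1 + η * τ‖ = 1 := by
    rw [norm_eq_of_norm_sub_lt (y := (1 : K)), norm_one]
    rwa [add_sub_cancel_left, norm_mul, hτ1, mul_one, hη, norm_one]
  have h2 : N (w * (1 + η * τ)) - u = N w * (N (1 + η * τ) - 1 - η) := by
    rw [hNmul]
    simp only [η, mul_sub, mul_one, mul_neg, mul_div_cancel₀ _ hNw0, he]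
    ring
  have h3 := hmin (show w * (1 + η * τ) ∈ Metric.sphere (0 : K) 1 by
    rw [mem_sphere_zero_iff_norm, norm_mul, hw, hητ, one_mul])
  have h4 : ‖N (w * (1 + η * τ)) - u‖ ≤ ‖e‖ ^ 2 := by
    rw [h2, norm_mul, hNnorm w hw, one_mul]; exact h1
  have h5 : ‖e‖ ≤ ‖e‖ ^ 2 := le_trans h3 h4
  have h6 : 0 < ‖e‖ := norm_pos_iff.mpr he0
  nlinarith

end CyclicNorm

section DegreePrime

variable {E D : Type*} [Field E] [DivisionRing D] [Algebra E D]

/-- Conjugation by a nonzero element of a division algebra. -/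
@[simps]
def conjAlgHom (E : Type*) [Field E] [Algebra E D] (y : D) (hy : y ≠ 0) : D →ₐ[E] D where
  toFun x := y * x * y⁻¹
  map_one' := by rw [mul_one, mul_inv_cancel₀ hy]
  map_mul' a b := by simp only [mul_assoc, inv_mul_cancel_left₀ hy]
  map_zero' := by rw [mul_zero, zero_mul]
  map_add' a b := by rw [mul_add, add_mul]
  commutes' r := by rw [← Algebra.commutes, mul_inv_cancel_right₀ hy]

/-- Conjugation by `y` on a subalgebra generated by one element that it maps into itself. -/
def conjAdjoin {z y : D} (hy : y ≠ 0) (h : y * z * y⁻¹ ∈ Algebra.adjoin E {z}) :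
    Algebra.adjoin E {z} →ₐ[E] Algebra.adjoin E {z} :=
  ((conjAlgHom E y hy).comp (Algebra.adjoin E {z}).val).codRestrict _ fun x => by
    have h1 : (Algebra.adjoin E {z}).map (conjAlgHom E y hy) ≤ Algebra.adjoin E {z} := by
      rw [AlgHom.map_adjoin_singleton]
      exact Algebra.adjoin_singleton_le h
    exact h1 ⟨x, x.2, rfl⟩

theorem coe_conjAdjoin {z y : D} (hy : y ≠ 0) (h : y * z * y⁻¹ ∈ Algebra.adjoin E {z})
    (x : Algebra.adjoin E {z}) : (conjAdjoin hy h x : D) = y * x * y⁻¹ := rfl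

theorem coe_conjAdjoin_pow {z y : D} (hy : y ≠ 0) (h : y * z * y⁻¹ ∈ Algebra.adjoin E {z}) (n : ℕ)
    (x : Algebra.adjoin E {z}) : ((conjAdjoin hy h ^ n) x : D) = y ^ n * x * (y ^ n)⁻¹ := by
  induction n with
  | zero => simp
  | succ n ih =>
    rw [pow_succ', AlgHom.mul_apply, coe_conjAdjoin, ih, pow_succ', mul_inv_rev]
    simp only [mul_assoc]

theorem commute_of_mem_adjoin_singleton {z a b : D} (ha : a ∈ Algebra.adjoin E {z})
    (hb : b ∈ Algebra.adjoin E {z}) : Commute a b :=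
  congrArg Subtype.val (mul_comm (⟨a, ha⟩ : Algebra.adjoin E {z}) ⟨b, hb⟩)

section RootOfUnity

omit [Field E] [Algebra E D]

/-- An element not commuting with a root of unity has a component on which the root of unity
acts through a nontrivial power. -/
theorem exists_mul_eq_pow_mul [CharZero D] {z y₀ : D} {m : ℕ} (hm : 0 < m) (hz : z ^ m = 1)
    (hzy : z * y₀ ≠ y₀ * z) : ∃ (y : D) (i : ℕ), y * z = z ^ i * y ∧ z * y ≠ y * z := by
  have hord : 0 < orderOf z := (isOfFinOrder_iff_pow_eq_one.mpr ⟨m, hm, hz⟩).orderOf_pos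
  set n := orderOf z with hn
  have hzn : z ^ n = 1 := pow_orderOf_eq_one z
  have hz0 : z ≠ 0 := fun h => by simp [h, hord.ne'] at hzn
  let Y : ℕ → D := fun i => ∑ j ∈ Finset.range n, (z⁻¹ ^ j) ^ i * y₀ * z ^ j
  have hY : ∀ i, Y i * z = z ^ i * Y i := fun i => by
    let f : ℕ → D := fun j => z ^ i * ((z⁻¹ ^ j) ^ i * y₀ * z ^ j)
    have h1 : ∀ j, (z⁻¹ ^ j) ^ i * y₀ * z ^ j * z = f (j + 1) := fun j => by
      have : z ^ i * (z⁻¹ ^ (j + 1)) ^ i = (z⁻¹ ^ j) ^ i := by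
        rw [pow_succ', (Commute.refl z⁻¹).pow_right j |>.mul_pow, inv_pow z i,
          mul_inv_cancel_left₀ (pow_ne_zero i hz0)]
      simp only [f]
      rw [pow_succ z j, ← this]
      simp only [mul_assoc]
    have h2 : f n = f 0 := by simp [f, hzn]
    have h3 := Finset.sum_range_succ' f n
    rw [Finset.sum_range_succ, h2] at h3
    simp only [Y, Finset.sum_mul, Finset.mul_sum, h1]
    exact (add_right_cancel h3).symm
  have hsum : ∑ i ∈ Finset.range n, Y i = n * y₀ := by
    simp only [Y]
    rw [Finset.sum_comm, Finset.sum_eq_single_of_mem 0 (Finset.mem_range.mpr hord)]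
    · simp
    · intro j hj hj0
      rw [← Finset.sum_mul, ← Finset.sum_mul]
      have hne : z⁻¹ ^ j ≠ 1 := fun h => by
        rw [inv_pow, inv_eq_one] at h
        exact Nat.not_dvd_of_pos_of_lt (Nat.pos_of_ne_zero hj0) (Finset.mem_range.mp hj)
          (orderOf_dvd_of_pow_eq_one h)
      have h2 := geom_sum_mul (z⁻¹ ^ j) n
      rw [← pow_mul, mul_comm j n, pow_mul, inv_pow z n, hzn, inv_one, one_pow, sub_self] at h2
      rw [(mul_eq_zero.mp h2).resolve_right (sub_ne_zero.mpr hne), zero_mul, zero_mul]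
  by_contra! hcon
  apply hzy
  have h : Commute z (∑ i ∈ Finset.range n, Y i) :=
    Commute.sum_right _ _ _ fun i _ => hcon (Y i) i (hY i)
  rw [hsum] at h
  have hn0 : (n : D) ≠ 0 := Nat.cast_ne_zero.mpr hord.ne'
  have h1 := (((Nat.cast_commute n z).symm.inv_right₀).mul_right h).eq
  rwa [inv_mul_cancel_left₀ hn0] at h1

end RootOfUnity

variable {p : ℕ} [Fact p.Prime] [Algebra.IsCentral E D]

omit [Algebra.IsCentral E D] in
theorem finiteDimensional_of_finrank_sq (hD : finrank E D = p ^ 2) : FiniteDimensional E D :=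
  FiniteDimensional.of_finrank_pos (by rw [hD]; exact pow_pos (Fact.out : p.Prime).pos 2)

theorem finrank_eq_one_or_prime (hD : finrank E D = p ^ 2) (A : Subalgebra E D)
    (hA : ∀ a ∈ A, ∀ b ∈ A, a * b = b * a) : finrank E A = 1 ∨ finrank E A = p := by
  have := finiteDimensional_of_finrank_sq hD
  have hp : p.Prime := Fact.out
  have hdvd : finrank E A ∣ p ^ 2 := by
    let := divisionRingOfFiniteDimensional E A
    rw [← hD, ← finrank_mul_finrank E A D]
    exact dvd_mul_right _ _
  obtain ⟨i, hi, h⟩ := (Nat.dvd_prime_pow hp).mp hdvd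
  interval_cases i
  · left; simpa using h
  · right; simpa using h
  · exfalso
    have htop : A = ⊤ := by
      apply Algebra.toSubmodule_eq_top.mp
      exact Submodule.eq_top_of_finrank_eq (h.trans hD.symm)
    subst htop
    have hbot : (⊤ : Subalgebra E D) = ⊥ := by
      rw [← Algebra.IsCentral.center_eq_bot E D, eq_comm, eq_top_iff]
      intro x _
      exact Subalgebra.mem_center_iff.mpr fun b => hA _ Algebra.mem_top _ Algebra.mem_top
    have h1 : finrank E (⊤ : Subalgebra E D) = 1 := by rw [hbot]; exact Subalgebra.finrank_bot
    rw [h1] at h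
    exact absurd h.symm (Nat.one_lt_pow two_ne_zero hp.one_lt).ne'

theorem finrank_adjoin_singleton (hD : finrank E D = p ^ 2) {z : D}
    (hz : z ∉ (⊥ : Subalgebra E D)) : finrank E (Algebra.adjoin E {z}) = p := by
  refine (finrank_eq_one_or_prime hD _ fun a ha b hb =>
    commute_of_mem_adjoin_singleton ha hb).resolve_left fun h => hz ?_
  rw [← Subalgebra.eq_bot_of_finrank_one h]
  exact Algebra.self_mem_adjoin_singleton E z

theorem mem_adjoin_of_commute (hD : finrank E D = p ^ 2) {z x : D}
    (hz : z ∉ (⊥ : Subalgebra E D)) (hxz : Commute z x) : x ∈ Algebra.adjoin E {z} := by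
  have := finiteDimensional_of_finrank_sq hD
  have hle : Algebra.adjoin E {z} ≤ Algebra.adjoin E {z, x} :=
    Algebra.adjoin_mono (by simp)
  have hcomm : ∀ a ∈ Algebra.adjoin E {z, x}, ∀ b ∈ Algebra.adjoin E {z, x}, a * b = b * a := by
    have : IsMulCommutative (Algebra.adjoin E {z, x}) := by
      refine Algebra.isMulCommutative_adjoin E ?_
      rintro a (rfl | rfl) b (rfl | rfl)
      exacts [rfl, hxz, hxz.symm, rfl]
    exact fun a ha b hb => congrArg Subtype.val
      (this.is_comm.comm (⟨a, ha⟩ : Algebra.adjoin E {z, x}) ⟨b, hb⟩)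
  have h1 := finrank_adjoin_singleton hD hz
  have h2 : finrank E (Algebra.adjoin E {z, x}) = p := by
    refine (finrank_eq_one_or_prime hD _ hcomm).resolve_left fun h => hz ?_
    rw [← Subalgebra.eq_bot_of_finrank_one h]
    exact Algebra.subset_adjoin (by simp)
  rw [Subalgebra.eq_of_le_of_finrank_eq hle (h1.trans h2.symm)]
  exact Algebra.subset_adjoin (by simp)

/-- An element normalising the field generated by `z` has `p`-th power commuting with `z`. -/
theorem commute_pow_of_conj_mem (hD : finrank E D = p ^ 2) {z y : D}
    (hz : z ∉ (⊥ : Subalgebra E D)) (hy : y ≠ 0) (h : y * z * y⁻¹ ∈ Algebra.adjoin E {z}) :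
    Commute z (y ^ p) := by
  have := finiteDimensional_of_finrank_sq hD
  let := adjoinSingletonField (F := E) z
  let W := Algebra.adjoin E {z}
  let σ : W ≃ₐ[E] W := (algEquivEquivAlgHom E W).symm (conjAdjoin hy h)
  have h1 : orderOf σ ∣ p := by
    rw [← finrank_adjoin_singleton hD hz, ← Nat.card_zpowers,
      ← IntermediateField.finrank_fixedField_eq_card (Subgroup.zpowers σ)]
    rw [← finrank_mul_finrank E (IntermediateField.fixedField (Subgroup.zpowers σ)) W]
    exact dvd_mul_left _ _
  have h2 : conjAdjoin hy h ^ p = 1 := by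
    apply (algEquivEquivAlgHom E W).symm.injective
    rw [map_pow, map_one]
    exact orderOf_dvd_iff_pow_eq_one.mp h1
  have h3 := coe_conjAdjoin_pow hy h p ⟨z, Algebra.self_mem_adjoin_singleton E z⟩
  rw [h2, AlgHom.one_apply] at h3
  exact (eq_mul_inv_iff_mul_eq₀ (pow_ne_zero p hy)).mp h3

theorem pow_prime_mem_bot (hD : finrank E D = p ^ 2) {z y : D}
    (hzy : z * y ≠ y * z) (h : y * z * y⁻¹ ∈ Algebra.adjoin E {z}) :
    y ^ p ∈ (⊥ : Subalgebra E D) := by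
  have := finiteDimensional_of_finrank_sq hD
  have hbot : ∀ {a b : D}, a ∈ (⊥ : Subalgebra E D) → Commute a b := by
    rintro _ b ⟨a, rfl⟩
    exact Algebra.commute_algebraMap_left a b
  have hz : z ∉ (⊥ : Subalgebra E D) := fun h => hzy (hbot h)
  have hy : y ∉ (⊥ : Subalgebra E D) := fun h => hzy (hbot h).symm
  have hy0 : y ≠ 0 := fun h => hy (h ▸ Subalgebra.zero_mem _)
  have h1 := mem_adjoin_of_commute hD hz (commute_pow_of_conj_mem hD hz hy0 h)
  have h2 : y ^ p ∈ Algebra.adjoin E {y} :=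
    pow_mem (Algebra.self_mem_adjoin_singleton E y) p
  by_contra hyp
  have hle : ∀ w : D, w ∉ (⊥ : Subalgebra E D) → y ^ p ∈ Algebra.adjoin E {w} →
      Algebra.adjoin E {y ^ p} = Algebra.adjoin E {w} := fun w hw hmem =>
    Subalgebra.eq_of_le_of_finrank_eq
      (Algebra.adjoin_singleton_le hmem)
      ((finrank_adjoin_singleton hD hyp).trans (finrank_adjoin_singleton hD hw).symm)
  have h3 := (hle z hz h1).symm.trans (hle y hy h2)
  refine hzy (commute_of_mem_adjoin_singleton (E := E) (z := y) ?_
    (Algebra.self_mem_adjoin_singleton E y))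
  rw [← h3]
  exact Algebra.self_mem_adjoin_singleton E z

end DegreePrime

section RamifiedCase

variable {p : ℕ} [Fact p.Prime]

theorem exists_mul_ne_mul_of_finrank_sq {E D : Type*} [Field E] [DivisionRing D] [Algebra E D]
    [Algebra.IsCentral E D] (hD : finrank E D = p ^ 2) : ∃ x y : D, x * y ≠ y * x := by
  by_contra! h
  have h1 : (⊤ : Subalgebra E D) = ⊥ :=
    (top_le_iff.mp (le_trans (fun x _ => Subalgebra.mem_center_iff.mpr fun y => h y x)
      (Algebra.IsCentral.out (K := E) (D := D)))).symm
  have h2 : finrank E D = 1 := Subalgebra.bot_eq_top_iff_finrank_eq_one.mp h1.symm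
  have := (Fact.out : p.Prime).one_lt
  nlinarith [h2.symm.trans hD]

theorem exists_prod_pow_eq_of_divisionNorm_eq_one {K : Type*} [Field K] [Algebra ℚ_[p] K]
    [FiniteDimensional ℚ_[p] K] (σ : K →ₐ[ℚ_[p]] K) (hp : σ ^ p = 1) {z : K} {m : ℕ}
    (hm : ¬ p ∣ m) (hzm : z ^ m = 1) (hz : σ z ≠ z) {u : K} (hu : σ u = u)
    (hu1 : divisionNorm p u = 1) : ∃ w : K, ∏ i ∈ Finset.range p, (σ ^ i) w = u := by
  let := padicNormedField p K
  let := padicNormedAlgebra p K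
  have := padic_isUltrametricDist p K
  have hpow : ∀ i x, ((σ : K →+* K) ^ i) x = (σ ^ i) x := fun i x => by
    rw [RingHom.coe_pow, AlgHom.coe_pow]; rfl
  obtain ⟨w, hw⟩ := exists_prod_pow_eq_of_norm_eq_one (p := p) (K := K) (σ : K →+* K)
    (divisionNorm_algHom p σ) (RingHom.ext fun x => by rw [hpow, hp]; rfl) hm hzm hz hu hu1
  exact ⟨w, by simpa only [hpow] using hw⟩

variable {F Δ : Type*} [Field F] [DivisionRing Δ] [Algebra F Δ]

theorem mul_pow_eq_prod_conj {y : Δ} (hy : y ≠ 0) (w : Δ) (n : ℕ) :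
    (w * y) ^ n = ((List.range n).map fun i => y ^ i * w * (y ^ i)⁻¹).prod * y ^ n := by
  induction n with
  | zero => simp
  | succ n ih =>
    rw [pow_succ, ih, List.range_succ, List.map_append, List.prod_append, List.map_singleton,
      List.prod_singleton, pow_succ y]
    have : y ^ n * (w * y) = y ^ n * w * (y ^ n)⁻¹ * (y ^ n * y) := by
      rw [mul_assoc (y ^ n * w), inv_mul_cancel_left₀ (pow_ne_zero n hy), mul_assoc]
    rw [mul_assoc, this, ← mul_assoc]

variable [Algebra.IsCentral F Δ]

theorem mem_bot_of_pow_prime_eq_one (hΔ : finrank F Δ = p ^ 2) {r : Δ} (hr : r ^ p = 1) :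
    r ∈ (⊥ : Subalgebra F Δ) := by
  have := finiteDimensional_of_finrank_sq hΔ
  have hp : p.Prime := Fact.out
  by_contra hmem
  let := adjoinSingletonField (F := F) r
  let K := Algebra.adjoin F {r}
  let x : K := ⟨r, Algebra.self_mem_adjoin_singleton F r⟩
  have hx : x ^ p = 1 := Subtype.ext hr
  have h1 : x ≠ 1 := fun h => hmem (by
    rw [show r = 1 from congrArg Subtype.val h]
    exact one_mem _)
  have h2 : ∑ i ∈ Finset.range p, x ^ i = 0 := by
    have := geom_sum_mul x p
    rw [hx, sub_self] at this
    exact (mul_eq_zero.mp this).resolve_right (sub_ne_zero.mpr h1)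
  have h3 : minpoly F x ∣ ∑ i ∈ Finset.range p, (Polynomial.X : Polynomial F) ^ i :=
    minpoly.dvd F x (by simpa using h2)
  have h4 : (∑ i ∈ Finset.range p, (Polynomial.X : Polynomial F) ^ i).natDegree < p := by
    refine lt_of_le_of_lt (Polynomial.natDegree_sum_le_of_forall_le (n := p - 1) _ _
      fun i hi => ?_) (Nat.sub_lt hp.pos one_pos)
    rw [Polynomial.natDegree_X_pow]
    exact Nat.le_sub_one_of_lt (Finset.mem_range.mp hi)
  have h5 : (∑ i ∈ Finset.range p, (Polynomial.X : Polynomial F) ^ i) ≠ 0 := fun h => by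
    have := congrArg (Polynomial.coeff · 0) h
    simp [Polynomial.coeff_X_pow, hp.pos.ne'] at this
  have h6 : (minpoly F x).natDegree ∣ p := by
    rw [← finrank_adjoin_singleton hΔ hmem]
    exact minpoly.degree_dvd (Algebra.IsIntegral.isIntegral x)
  rcases (Nat.dvd_prime hp).mp h6 with h6 | h6
  · obtain ⟨a, ha⟩ := minpoly.natDegree_eq_one_iff.mp h6
    exact hmem ⟨a, congrArg Subtype.val ha⟩
  · exact absurd (Polynomial.natDegree_le_of_dvd h3 h5) (not_le.mpr (h6 ▸ h4))

variable [Algebra ℚ_[p] F] [FiniteDimensional ℚ_[p] F] [Algebra ℚ_[p] Δ] [IsScalarTower ℚ_[p] F Δ]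

/-- A symbol presentation whose constant is a unit up to a `p`-th power contradicts being a
division algebra. -/
theorem false_of_eq_unit_mul_pow (hΔ : finrank F Δ = p ^ 2) {z y : Δ} {m : ℕ} (hm : ¬ p ∣ m)
    (hzm : z ^ m = 1) (hzy : z * y ≠ y * z) (h : y * z * y⁻¹ ∈ Algebra.adjoin F {z})
    {c u t : F} (hyc : y ^ p = algebraMap F Δ c) (hcu : c = u * t ^ p)
    (hu : divisionNorm p u = 1) : False := by
  have := finiteDimensional_of_finrank_sq hΔ
  have hy : y ≠ 0 := fun h => hzy (by rw [h, mul_zero, zero_mul])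
  let := adjoinSingletonField (F := F) z
  let K := Algebra.adjoin F {z}
  have : FiniteDimensional ℚ_[p] K := FiniteDimensional.trans ℚ_[p] F K
  let σ : K →ₐ[F] K := conjAdjoin hy h
  have hσ : ∀ i x, ((σ ^ i) x : Δ) = y ^ i * x * (y ^ i)⁻¹ := coe_conjAdjoin_pow hy h
  have hu0 : u ≠ 0 := fun h => by
    rw [h, divisionNorm_zero] at hu
    exact zero_ne_one hu
  have hc0 : c ≠ 0 := fun h => pow_ne_zero p hy (by rw [hyc, h, map_zero])
  have ht0 : t ≠ 0 := fun h => hc0 (by rw [hcu, h, zero_pow (Fact.out : p.Prime).ne_zero, mul_zero])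
  have hσp : σ ^ p = 1 := AlgHom.ext fun x => Subtype.ext (by
    rw [hσ, hyc, Algebra.commutes, mul_inv_cancel_right₀]; rfl
    rw [← hyc]; exact pow_ne_zero p hy)
  let zK : K := ⟨z, Algebra.self_mem_adjoin_singleton F z⟩
  have hpow : ∀ i x, ((σ.restrictScalars ℚ_[p]) ^ i) x = (σ ^ i) x := fun i x => by
    rw [AlgHom.coe_pow, AlgHom.coe_pow]; rfl
  obtain ⟨w, hw⟩ := exists_prod_pow_eq_of_divisionNorm_eq_one (p := p)
    (σ.restrictScalars ℚ_[p]) (AlgHom.ext fun x => by rw [hpow, hσp]; rfl)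
    (z := zK) hm (Subtype.ext hzm) (fun h => hzy (by
      have h1 := congrArg Subtype.val h
      exact ((mul_inv_eq_iff_eq_mul₀ hy).mp h1).symm))
    (u := algebraMap F K u⁻¹) (σ.commutes _) (by
      have h1 := divisionNorm_mul p u u⁻¹
      rw [mul_inv_cancel₀ hu0, divisionNorm_one, hu, one_mul] at h1
      rw [h1, ← divisionNorm_algHom p (IsScalarTower.toAlgHom ℚ_[p] F K)]
      rfl)
  have hw' : ((List.range p).map fun i => y ^ i * (w : Δ) * (y ^ i)⁻¹).prod =
      algebraMap F Δ u⁻¹ := by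
    have h1 : ∀ n, ((∏ i ∈ Finset.range n, (σ ^ i) w : K) : Δ) =
        ((List.range n).map fun i => y ^ i * (w : Δ) * (y ^ i)⁻¹).prod := fun n => by
      induction n with
      | zero => rfl
      | succ n ih =>
        rw [Finset.prod_range_succ, List.range_succ, List.map_append, List.prod_append,
          List.map_singleton, List.prod_singleton, ← ih, ← hσ]
        rfl
    rw [← h1]
    simp only [hpow] at hw
    exact congrArg Subtype.val hw
  have hwy : ((w : Δ) * y) ^ p = algebraMap F Δ (t ^ p) := by
    rw [mul_pow_eq_prod_conj hy, hw', hyc, hcu, ← map_mul, inv_mul_cancel_left₀ hu0]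
  have hr : ((w : Δ) * y * algebraMap F Δ t⁻¹) ^ p = 1 := by
    rw [(Algebra.commute_algebraMap_right t⁻¹ ((w : Δ) * y)).mul_pow, hwy, ← map_pow, ← map_mul,
      ← mul_pow, mul_inv_cancel₀ ht0, one_pow, map_one]
  obtain ⟨a, ha⟩ := mem_bot_of_pow_prime_eq_one hΔ hr
  have ha' : (w : Δ) * y = algebraMap F Δ (a * t) := by
    rw [map_mul, show algebraMap F Δ a = _ from ha, mul_assoc, ← map_mul, inv_mul_cancel₀ ht0,
      map_one, mul_one]
  have hw0 : (w : Δ) ≠ 0 := fun h => by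
    rw [h, zero_mul, zero_pow (Fact.out : p.Prime).ne_zero] at hwy
    exact pow_ne_zero p ht0 ((algebraMap F Δ).injective (by rw [← hwy, map_zero]))
  have hzw : Commute z w := commute_of_mem_adjoin_singleton
    (Algebra.self_mem_adjoin_singleton F z) w.2
  have hzwy : Commute z ((w : Δ) * y) := ha' ▸ Algebra.commute_algebraMap_right _ z
  apply hzy
  have h1 := (hzw.inv_right₀.mul_right hzwy).eq
  rwa [inv_mul_cancel_left₀ hw0] at h1

theorem false_of_ramified_scalar_extension {E D : Type*} [Field E] [DivisionRing D] [Algebra E D]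
    [Algebra.IsCentral E D] (hD : finrank E D = p ^ 2) [Algebra ℚ_[p] E]
    [FiniteDimensional ℚ_[p] E] [Algebra E F] [IsScalarTower ℚ_[p] E F]
    (hram : ∀ c : E, c ≠ 0 → ∃ t : F, divisionNorm p (algebraMap E F c) = divisionNorm p t ^ p)
    (hΔ : finrank F Δ = p ^ 2) (f : D →+* Δ)
    (hf : ∀ c : E, f (algebraMap E D c) = algebraMap F Δ (algebraMap E F c)) : False := by
  have hp : p.Prime := Fact.out
  have := finiteDimensional_of_finrank_sq hD
  let : Algebra ℚ_[p] D := Algebra.compHom D (algebraMap ℚ_[p] E)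
  have : IsScalarTower ℚ_[p] E D := IsScalarTower.of_algebraMap_eq fun _ => rfl
  have : FiniteDimensional ℚ_[p] D := FiniteDimensional.trans ℚ_[p] E D
  have hnc : ∃ x y : D, x * y ≠ y * x := exists_mul_ne_mul_of_finrank_sq hD
  obtain ⟨z, y₀, s, hs, hz, hzy₀⟩ : ∃ z y : D, ∃ s, s ≠ 0 ∧ z ^ p ^ s = z ∧ z * y ≠ y * z := by
    let := padicNormedDivisionRing p D
    let := padicNormedAlgebra p D
    have := padic_isUltrametricDist p D
    exact exists_teichmuller_notMem_center (p := p) hnc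
  have hz0 : z ≠ 0 := fun h => hzy₀ (by rw [h, zero_mul, mul_zero])
  have hq : 1 < p ^ s := Nat.one_lt_pow hs hp.one_lt
  have hzm : z ^ (p ^ s - 1) = 1 := by
    refine mul_right_cancel₀ hz0 ?_
    rw [← pow_succ, Nat.sub_add_cancel hq.le, hz, one_mul]
  have hm : ¬ p ∣ p ^ s - 1 := fun h => hp.one_lt.ne' (Nat.dvd_one.mp
    ((Nat.dvd_sub_iff_right hq.le (dvd_pow_self p hs)).mp h))
  have : CharZero D := charZero_of_injective_algebraMap (algebraMap ℚ_[p] D).injective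
  obtain ⟨y, i, hyz, hzy⟩ := exists_mul_eq_pow_mul (Nat.sub_pos_of_lt hq) hzm hzy₀
  have hy : y ≠ 0 := fun h => hzy (by rw [h, zero_mul, mul_zero])
  have hconj : y * z * y⁻¹ = z ^ i := by rw [hyz, mul_inv_cancel_right₀ hy]
  obtain ⟨c, hc⟩ := pow_prime_mem_bot hD hzy (y := y) (by
    rw [hconj]; exact pow_mem (Algebra.self_mem_adjoin_singleton E z) i)
  replace hc : algebraMap E D c = y ^ p := hc
  have hc0 : c ≠ 0 := fun h => pow_ne_zero p hy (by rw [← hc, h, map_zero])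
  obtain ⟨t, ht⟩ := hram c hc0
  have ht0 : t ≠ 0 := fun h => by
    rw [h, divisionNorm_zero, zero_pow hp.ne_zero] at ht
    exact hc0 ((algebraMap E F).injective (by rw [eq_zero_of_divisionNorm_eq_zero p ht, map_zero]))
  have hnpow : ∀ n : ℕ, divisionNorm p (t ^ n) = divisionNorm p t ^ n := fun n => by
    induction n with
    | zero => rw [pow_zero, pow_zero, divisionNorm_one]
    | succ n ih => rw [pow_succ, divisionNorm_mul, ih, pow_succ]
  refine false_of_eq_unit_mul_pow hΔ (z := f z) (y := f y) hm
    (by rw [← map_pow, hzm, map_one]) (fun h => hzy (f.injective (by simpa using h)))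
    (by rw [← map_inv₀, ← map_mul, ← map_mul, hconj, map_pow]
        exact pow_mem (Algebra.self_mem_adjoin_singleton F (f z)) i)
    (c := algebraMap E F c) (u := algebraMap E F c * (t ^ p)⁻¹) (t := t)
    (by rw [← map_pow, ← hc, hf]) (inv_mul_cancel_right₀ (pow_ne_zero p ht0) _).symm ?_
  have h1 : divisionNorm p (algebraMap E F c * (t ^ p)⁻¹) * divisionNorm p (t ^ p) =
      divisionNorm p t ^ p := by
    rw [← divisionNorm_mul, inv_mul_cancel_right₀ (pow_ne_zero p ht0), ht]
  rw [hnpow] at h1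
  refine mul_right_cancel₀ (pow_ne_zero p fun h => ht0 (eq_zero_of_divisionNorm_eq_zero p h))
    (h1.trans (one_mul _).symm)

end RamifiedCase

section ScalarExtension

variable {E F D : Type*} [Field E] [Field F] [Algebra E F] [DivisionRing D] [Algebra E D]

theorem equivFinsuppOfBasisLeft_one_tmul_mul {ι : Type*} [DecidableEq ι] (b : Basis ι E F) (d : D)
    (x : F ⊗[E] D) (i : ι) : TensorProduct.equivFinsuppOfBasisLeft b ((1 ⊗ₜ d) * x) i =
      d * TensorProduct.equivFinsuppOfBasisLeft b x i := by
  induction x with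
  | zero => simp
  | tmul u v => simp
  | add u v hu hv => rw [mul_add, map_add, map_add, Finsupp.add_apply, Finsupp.add_apply, hu, hv,
      mul_add]

theorem equivFinsuppOfBasisLeft_mul_one_tmul {ι : Type*} [DecidableEq ι] (b : Basis ι E F) (d : D)
    (x : F ⊗[E] D) (i : ι) : TensorProduct.equivFinsuppOfBasisLeft b (x * (1 ⊗ₜ d)) i =
      TensorProduct.equivFinsuppOfBasisLeft b x i * d := by
  induction x with
  | zero => simp
  | tmul u v => simp
  | add u v hu hv => rw [add_mul, map_add, map_add, Finsupp.add_apply, Finsupp.add_apply, hu, hv,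
      add_mul]

variable [Algebra.IsCentral E D]

theorem exists_eq_tmul_one_of_commute {x : F ⊗[E] D}
    (h : ∀ d : D, ((1 : F) ⊗ₜ[E] d) * x = x * (1 ⊗ₜ d)) : ∃ a : F, x = a ⊗ₜ 1 := by
  classical
  let b := Basis.ofVectorSpace E F
  let φ := TensorProduct.equivFinsuppOfBasisLeft (N := D) b
  have h1 : ∀ i, ∃ c : E, φ x i = algebraMap E D c := fun i =>
    (Algebra.IsCentral.mem_center_iff E).mp (Subalgebra.mem_center_iff.mpr fun d => by
      rw [← equivFinsuppOfBasisLeft_one_tmul_mul, ← equivFinsuppOfBasisLeft_mul_one_tmul, h])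
  choose c hc using h1
  refine ⟨∑ i ∈ (φ x).support, c i • b i, ?_⟩
  rw [TensorProduct.sum_tmul]
  refine (φ.symm_apply_apply x).symm.trans
    ((TensorProduct.equivFinsuppOfBasisLeft_symm_apply b (φ x)).trans ?_)
  refine Finset.sum_congr rfl fun i _ => ?_
  rw [hc, Algebra.algebraMap_eq_smul_one]
  exact (TensorProduct.tmul_smul _ _ _).trans (TensorProduct.smul_tmul' _ _ _)

instance isCentral_scalarExtension : Algebra.IsCentral F (F ⊗[E] D) where
  out x hx := by
    obtain ⟨a, rfl⟩ := exists_eq_tmul_one_of_commute (x := x)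
      fun d => Subalgebra.mem_center_iff.mp hx _
    exact ⟨a, rfl⟩

instance isSimpleRing_scalarExtension : IsSimpleRing (F ⊗[E] D) := by
  classical
  let b := Basis.ofVectorSpace E F
  let φ := TensorProduct.equivFinsuppOfBasisLeft (N := D) b
  refine .of_eq_bot_or_eq_top fun I => or_iff_not_imp_left.mpr fun hI => ?_
  have hne : ∃ x ∈ I, x ≠ 0 := by
    by_contra! h
    exact hI (le_bot_iff.mp fun x hx => h x hx)
  obtain ⟨x, ⟨hxI, hx0⟩, hmin⟩ := exists_minimalFor_of_wellFoundedLT _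
    (fun x => (φ x).support.card) hne
  obtain ⟨i, hi⟩ : ∃ i, φ x i ≠ 0 := by
    by_contra! h
    exact hx0 (φ.injective (by rw [map_zero]; exact Finsupp.ext h))
  let x' := ((1 : F) ⊗ₜ[E] (φ x i)⁻¹) * x
  have hφ : ∀ j, φ x' j = (φ x i)⁻¹ * φ x j := equivFinsuppOfBasisLeft_one_tmul_mul b _ x
  have hx'I : x' ∈ I := I.mul_mem_left _ _ hxI
  have hx'0 : x' ≠ 0 := fun h => by
    have := hφ i
    rw [h, map_zero, Finsupp.zero_apply, inv_mul_cancel₀ hi] at this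
    exact zero_ne_one this
  have hcomm : ∀ d : D, ((1 : F) ⊗ₜ[E] d) * x' = x' * (1 ⊗ₜ d) := fun d => by
    by_contra hd
    have hsub : ∀ j, φ ((1 ⊗ₜ d) * x' - x' * (1 ⊗ₜ d)) j =
        d * ((φ x i)⁻¹ * φ x j) - (φ x i)⁻¹ * φ x j * d := fun j => by
      rw [map_sub, Finsupp.sub_apply, ← hφ]
      exact congrArg₂ _ (equivFinsuppOfBasisLeft_one_tmul_mul b _ _ _)
        (equivFinsuppOfBasisLeft_mul_one_tmul b _ _ _)
    have hlt : (φ ((1 ⊗ₜ d) * x' - x' * (1 ⊗ₜ d))).support.card < (φ x).support.card := by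
      refine Finset.card_lt_card (Finset.ssubset_iff_of_subset (fun j hj => ?_) |>.mpr
        ⟨i, Finsupp.mem_support_iff.mpr hi, fun h => Finsupp.mem_support_iff.mp h ?_⟩)
      · refine Finsupp.mem_support_iff.mpr fun h => Finsupp.mem_support_iff.mp hj ?_
        rw [hsub, h, mul_zero, mul_zero, zero_mul, sub_zero]
      · rw [hsub, inv_mul_cancel₀ hi, mul_one, one_mul, sub_self]
    exact hlt.not_ge (hmin ⟨I.sub_mem (I.mul_mem_left _ _ hx'I) (I.mul_mem_right _ _ hx'I),
      sub_ne_zero.mpr hd⟩ hlt.le)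
  obtain ⟨a, ha⟩ := exists_eq_tmul_one_of_commute hcomm
  have ha0 : a ≠ 0 := fun h => hx'0 (by rw [ha, h, TensorProduct.zero_tmul])
  refine (TwoSidedIdeal.one_mem_iff I).mp ?_
  have h1 := I.mul_mem_left (a⁻¹ ⊗ₜ[E] (1 : D)) _ hx'I
  rwa [ha, Algebra.TensorProduct.tmul_mul_tmul, inv_mul_cancel₀ ha0, mul_one] at h1

/-- A representation of `D` by matrices of the right size over `F` splits `D` over `F`. -/
theorem nonempty_scalarExtension_algEquiv_matrix {p : ℕ} [Fact p.Prime]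
    (hD : finrank E D = p ^ 2) (g : D →ₐ[E] Matrix (Fin p) (Fin p) F) :
    Nonempty ((F ⊗[E] D) ≃ₐ[F] Matrix (Fin p) (Fin p) F) := by
  have : FiniteDimensional E D := finiteDimensional_of_finrank_sq hD
  have : Nonempty (Fin p) := ⟨⟨0, (Fact.out : p.Prime).pos⟩⟩
  let f : (F ⊗[E] D) →ₐ[F] Matrix (Fin p) (Fin p) F :=
    Algebra.TensorProduct.lift (Algebra.ofId F _) g fun a d => Algebra.commutes a (g d)
  have hf : Function.Injective f := RingHom.injective f.toRingHom
  refine ⟨AlgEquiv.ofBijective f ⟨hf, ?_⟩⟩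
  refine (LinearMap.injective_iff_surjective_of_finrank_eq_finrank (f := f.toLinearMap) ?_).mp hf
  rw [finrank_baseChange, hD, finrank_matrix, finrank_self, Fintype.card_fin, mul_one, sq]

end ScalarExtension

universe u in
theorem nonempty_algEquiv_matrix_or_divisionRing {p : ℕ} [Fact p.Prime] {F : Type*} {A : Type u}
    [Field F] [Ring A] [Algebra F A] [IsSimpleRing A] (hA : finrank F A = p ^ 2) :
    Nonempty (A ≃ₐ[F] Matrix (Fin p) (Fin p) F) ∨
      ∃ (Δ : Type u) (_ : DivisionRing Δ) (_ : Algebra F Δ), Nonempty (A ≃ₐ[F] Δ) := by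
  have hp : p.Prime := Fact.out
  have : FiniteDimensional F A :=
    FiniteDimensional.of_finrank_pos (by rw [hA]; exact pow_pos hp.pos 2)
  have : IsArtinianRing A := IsArtinianRing.of_finite F A
  obtain ⟨n, hn, Δ, _, _, _, ⟨e⟩⟩ := IsSimpleRing.exists_algEquiv_matrix_divisionRing_finite F A
  have hdim : n * n * finrank F Δ = p ^ 2 := by
    rw [← hA, e.toLinearEquiv.finrank_eq, finrank_matrix, Fintype.card_fin]
  have hnp : n ∣ p := (Nat.pow_dvd_pow_iff two_ne_zero).mp ⟨_, by rw [← hdim, sq]⟩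
  rcases (Nat.dvd_prime hp).mp hnp with rfl | rfl
  · have e' : Matrix (Fin 1) (Fin 1) Δ ≃ₐ[F] Δ := by
      convert! Matrix.uniqueAlgEquiv (m := Fin 1) (A := Δ) (R := F)
    exact .inr ⟨Δ, _, _, ⟨e.trans e'⟩⟩
  · have h1 : finrank F Δ = 1 := by
      refine Nat.eq_of_mul_eq_mul_left (mul_pos hp.pos hp.pos) ?_
      rw [hdim, sq, mul_one]
    exact .inl ⟨e.trans (AlgEquiv.ofBijective (Algebra.ofId F Δ)
      (Algebra.finrank_eq_one_iff_bijective_algebraMap.mp h1)).symm.mapMatrix⟩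

section ResidueAction

variable {p : ℕ} [Fact p.Prime] {K : Type*} [NormedField K] [NormedAlgebra ℚ_[p] K]
  [IsUltrametricDist K]

theorem residue_eq_zero_iff_norm_lt_one (x : (NormedField.valuation (K := K)).integer) :
    IsLocalRing.residue _ x = 0 ↔ ‖(x : K)‖ < 1 := by
  rw [IsLocalRing.residue_eq_zero_iff, IsLocalRing.mem_maximalIdeal, mem_nonunits_iff,
    (Valuation.integer.integers (NormedField.valuation (K := K))).isUnit_iff_valuation_eq_one]
  have h : ‖(x : K)‖ ≤ 1 := x.2
  rw [← not_le, not_iff_not]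
  refine ⟨fun h1 => (congrArg NNReal.toReal h1).ge, fun h1 => ?_⟩
  exact NNReal.eq (le_antisymm h h1)

theorem finite_residueField_integer [ProperSpace K] :
    Finite (IsLocalRing.ResidueField (NormedField.valuation (K := K)).integer) := by
  obtain ⟨t, hts, htf, ht⟩ :=
    (isCompact_closedBall (0 : K) 1).finite_cover_balls (e := 1) one_pos
  have := htf.to_subtype
  refine Finite.of_surjective (α := t) (fun x => IsLocalRing.residue _ ⟨x, by
    have := hts x.2
    rwa [mem_closedBall_zero_iff] at this⟩) fun y => ?_
  obtain ⟨y, rfl⟩ := IsLocalRing.residue_surjective y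
  have hy := ht (mem_closedBall_zero_iff.mpr y.2)
  obtain ⟨x, hx, hxy⟩ := Set.mem_iUnion₂.mp hy
  refine ⟨⟨x, hx⟩, ?_⟩
  rw [← sub_eq_zero, ← map_sub, residue_eq_zero_iff_norm_lt_one]
  rw [Metric.mem_ball, dist_comm, dist_eq_norm] at hxy
  exact hxy

/-- A group of isometric automorphisms of a `p`-adic field that acts faithfully on the residue
field is cyclic. -/
theorem isCyclic_of_faithful_on_residueField [FiniteDimensional ℚ_[p] K] {G : Type*} [Group G]
    (ρ : G →* RingAut K) (hρ : ∀ g x, ‖ρ g x‖ = ‖x‖)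
    (hfaith : ∀ g, (∀ x : K, ‖x‖ ≤ 1 → ‖ρ g x - x‖ < 1) → g = 1) : IsCyclic G := by
  have hp : p.Prime := Fact.out
  have := properSpace_of_finiteDimensional_padic p K
  let O := (NormedField.valuation (K := K)).integer
  let κ := IsLocalRing.ResidueField O
  have : Finite κ := finite_residueField_integer
  have : CharP κ p := (CharP.charP_iff_prime_eq_zero hp).mpr (by
    have := (residue_eq_zero_iff_norm_lt_one (p : O)).mpr (by simpa using norm_prime_lt_one p K)
    rwa [map_natCast] at this)
  let := ZMod.algebra κ p
  let act : G → O ≃+* O := fun g => 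
    { toFun := fun x => ⟨ρ g x, (hρ g x).trans_le x.2⟩
      invFun := fun x => ⟨ρ g⁻¹ x, (hρ g⁻¹ x).trans_le x.2⟩
      left_inv := fun x => Subtype.ext (by
        change (ρ g⁻¹ * ρ g) x = x
        rw [← map_mul, inv_mul_cancel, map_one]; rfl)
      right_inv := fun x => Subtype.ext (by
        change (ρ g * ρ g⁻¹) x = x
        rw [← map_mul, mul_inv_cancel, map_one]; rfl)
      map_mul' := fun x y => Subtype.ext (map_mul (ρ g) _ _)
      map_add' := fun x y => Subtype.ext (map_add (ρ g) _ _) }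
  let φ : G →* (κ ≃ₐ[ZMod p] κ) :=
    { toFun := fun g => AlgEquiv.ofRingEquiv (f := IsLocalRing.ResidueField.mapEquiv (act g))
        fun r => RingHom.congr_fun (RingHom.ext_zmod
          (((IsLocalRing.ResidueField.mapEquiv (act g)) : κ →+* κ).comp (algebraMap (ZMod p) κ)) _) r
      map_one' := AlgEquiv.ext fun x => by
        obtain ⟨x, rfl⟩ := IsLocalRing.residue_surjective x
        exact congrArg (IsLocalRing.residue O) (Subtype.ext (by
          change ρ 1 x = x
          rw [map_one]; rfl))
      map_mul' := fun g h => AlgEquiv.ext fun x => by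
        obtain ⟨x, rfl⟩ := IsLocalRing.residue_surjective x
        exact congrArg (IsLocalRing.residue O) (Subtype.ext (by
          change ρ (g * h) x = ρ g (ρ h x)
          rw [map_mul]; rfl)) }
  refine isCyclic_of_injective φ ((injective_iff_map_eq_one φ).mpr fun g hg => hfaith g ?_)
  intro x hx
  have h1 : IsLocalRing.residue O (act g ⟨x, hx⟩) = IsLocalRing.residue O ⟨x, hx⟩ :=
    DFunLike.congr_fun hg (IsLocalRing.residue O ⟨x, hx⟩)
  rw [← sub_eq_zero, ← map_sub, residue_eq_zero_iff_norm_lt_one] at h1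
  exact h1

end ResidueAction

section Unramified

theorem Subgroup.eq_of_card_eq_of_isCyclic {G : Type*} [Group G] [Finite G] [IsCyclic G]
    {H₁ H₂ : Subgroup G} (h : Nat.card H₁ = Nat.card H₂) : H₁ = H₂ := by
  classical
  have := Fintype.ofFinite G
  have key : ∀ H : Subgroup G, Nat.card H = Nat.card H₁ →
      (H : Set G).toFinset = Finset.univ.filter fun g : G => g ^ Nat.card H₁ = 1 := fun H hH => by
    refine Finset.eq_of_subset_of_card_le (fun g hg => ?_) ?_
    · rw [Finset.mem_filter, ← hH]
      exact ⟨Finset.mem_univ g, by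
        have : (⟨g, Set.mem_toFinset.mp hg⟩ : H) ^ Nat.card H = 1 := pow_card_eq_one'
        exact congrArg Subtype.val this⟩
    · refine (IsCyclic.card_pow_eq_one_le Nat.card_pos).trans ?_
      rw [← hH, Set.toFinset_card, Nat.card_eq_fintype_card]
      exact le_rfl
  exact SetLike.coe_injective (Set.toFinset_inj.mp ((key H₁ rfl).trans (key H₂ h.symm).symm))

variable {p : ℕ} [Fact p.Prime] {E : Type*} [Field E] [Algebra ℚ_[p] E]
  [FiniteDimensional ℚ_[p] E]

/-- The extension generated by the `(p ^ s - 1)`-th roots of unity is cyclic. -/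
theorem isCyclic_splittingField_X_pow_sub_X {s : ℕ} (hs : s ≠ 0) :
    IsCyclic Gal((Polynomial.X ^ p ^ s - Polynomial.X : Polynomial E).SplittingField/E) := by
  set f : Polynomial E := Polynomial.X ^ p ^ s - Polynomial.X
  let K := f.SplittingField
  have : IsScalarTower ℚ_[p] E K := inferInstance
  have : FiniteDimensional ℚ_[p] K := FiniteDimensional.trans ℚ_[p] E K
  let := padicNormedField p K
  let := padicNormedAlgebra p K
  have := padic_isUltrametricDist p K
  have hiso : ∀ (g : Gal(K/E)) (x : K), ‖g x‖ = ‖x‖ := fun g x =>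
    divisionNorm_algHom p ((g : K →ₐ[E] K).restrictScalars ℚ_[p]) x
  refine isCyclic_of_faithful_on_residueField (p := p) (K := K)
    (MulSemiringAction.toRingAut Gal(K/E) K) hiso fun g hg => ?_
  have h1 : (g : K →ₐ[E] K) = AlgHom.id E K := by
    refine AlgHom.ext_of_adjoin_eq_top (Polynomial.SplittingField.adjoin_rootSet f) fun x hx => ?_
    have hxp : ∀ x ∈ f.rootSet K, x ^ p ^ s = x := fun x hx => by
      have := Polynomial.aeval_eq_zero_of_mem_rootSet hx
      simpa [f, sub_eq_zero] using this
    have hx1 := hxp x hx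
    have hn : ∀ y : K, y ^ p ^ s = y → ‖y‖ ≤ 1 := fun y hy => by
      by_contra! h
      have := pow_lt_pow_right₀ h (Nat.one_lt_pow hs (Fact.out : p.Prime).one_lt)
      rw [pow_one, ← norm_pow, hy] at this
      exact lt_irrefl _ this
    exact eq_of_pow_primePow_eq (p := p) (Commute.all _ _) hs
      (by rw [← map_pow, hx1]) hx1 (hn _ (by rw [← map_pow, hx1])) (hn _ hx1) (hg x (hn x hx1))
  exact AlgEquiv.ext fun x => AlgHom.congr_fun h1 x

theorem splits_of_dvd_X_pow_sub_X {F : Type*} [Field F] [Algebra E F] (hF : finrank E F = p)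
    {s : ℕ} (hs : s ≠ 0) {a : F} (ha : a ^ p ^ s = a) (haE : a ∉ (⊥ : Subalgebra E F))
    {g : Polynomial E} (hgm : g.Monic) (hgi : Irreducible g) (hgp : g.natDegree = p)
    (hg : g ∣ Polynomial.X ^ p ^ s - Polynomial.X) : (g.map (algebraMap E F)).Splits := by
  have hp : p.Prime := Fact.out
  have : FiniteDimensional E F := FiniteDimensional.of_finrank_pos (by rw [hF]; exact hp.pos)
  have hcyc := isCyclic_splittingField_X_pow_sub_X (p := p) (E := E) hs
  set f : Polynomial E := Polynomial.X ^ p ^ s - Polynomial.X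
  have hf0 : f ≠ 0 := FiniteField.X_pow_card_sub_X_ne_zero E (Nat.one_lt_pow hs hp.one_lt)
  let K := f.SplittingField
  have hfK : (f.map (algebraMap E K)).Splits := Polynomial.SplittingField.splits f
  have hdvd : ∀ q : Polynomial E, q ∣ f → (q.map (algebraMap E K)).Splits := fun q hq =>
    hfK.of_dvd (Polynomial.map_ne_zero hf0) (Polynomial.map_dvd _ hq)
  have : CharZero E := charZero_of_injective_algebraMap (algebraMap ℚ_[p] E).injective
  have : IsGalois E K := { to_normal := Normal.of_isSplittingField f }
  have htop : IntermediateField.adjoin E {a} = ⊤ := by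
    have := IntermediateField.isSimpleOrder_of_finrank_prime E F (hF ▸ hp)
    refine (eq_bot_or_eq_top _).resolve_left fun h => haE ?_
    exact IntermediateField.mem_bot.mp (h ▸ IntermediateField.mem_adjoin_simple_self E a)
  obtain ⟨j⟩ : Nonempty (F →ₐ[E] K) := IntermediateField.nonempty_algHom_of_adjoin_splits
    (S := {a}) (fun x hx => ⟨Algebra.IsIntegral.isIntegral x, hdvd _ (minpoly.dvd E x (by
      rw [Set.mem_singleton_iff.mp hx]; simp [f, ha]))⟩) htop
  have hmem : ∀ b ∈ g.rootSet K, b ∈ j.fieldRange := fun b hb => by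
    have hb0 := Polynomial.aeval_eq_zero_of_mem_rootSet hb
    have h1 : finrank E (IntermediateField.adjoin E {b}) = p := by
      rw [IntermediateField.adjoin.finrank (Algebra.IsIntegral.isIntegral b),
        ← minpoly.eq_of_irreducible_of_monic hgi hb0 hgm, hgp]
    have h2 : finrank E j.fieldRange = p := by
      rw [← hF]
      exact (AlgEquiv.ofInjectiveField j).toLinearEquiv.finrank_eq.symm
    have h3 : IntermediateField.adjoin E {b} = j.fieldRange := by
      refine IsGalois.intermediateFieldEquivSubgroup.injective
        (congrArg OrderDual.toDual (Subgroup.eq_of_card_eq_of_isCyclic ?_))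
      change Nat.card (IntermediateField.fixingSubgroup _) =
        Nat.card (IntermediateField.fixingSubgroup _)
      rw [IsGalois.card_fixingSubgroup_eq_finrank, IsGalois.card_fixingSubgroup_eq_finrank]
      refine Nat.eq_of_mul_eq_mul_left hp.pos ?_
      conv_lhs => rw [← h1]
      conv_rhs => rw [← h2]
      rw [finrank_mul_finrank, finrank_mul_finrank]
    rw [← h3]
    exact IntermediateField.mem_adjoin_simple_self E b
  have h4 := (IntermediateField.splits_iff_mem (hdvd g hg) (F := j.fieldRange)).mpr hmem
  let e : j.fieldRange ≃ₐ[E] F := (AlgEquiv.ofInjectiveField j).symm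
  have h5 := h4.map (e : j.fieldRange →+* F)
  rwa [Polynomial.map_map, show (e : j.fieldRange →+* F).comp (algebraMap E j.fieldRange) =
    algebraMap E F from RingHom.ext fun x => e.commutes x] at h5

end Unramified

universe u v w

section Splitting

variable {p : ℕ} [Fact p.Prime] {E : Type u} {F : Type v} {D : Type w}
  [Field E] [Field F] [Algebra E F] [DivisionRing D] [Algebra E D] [Algebra.IsCentral E D]

theorem nonempty_algEquiv_matrix_of_forall_divisionRing (hD : finrank E D = p ^ 2)
    (h : ∀ (Δ : Type (max v w)) [DivisionRing Δ] [Algebra F Δ] [Algebra.IsCentral F Δ]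
      (f : D →+* Δ), finrank F Δ = p ^ 2 →
      (∀ c : E, f (algebraMap E D c) = algebraMap F Δ (algebraMap E F c)) → False) :
    Nonempty ((F ⊗[E] D) ≃ₐ[F] Matrix (Fin p) (Fin p) F) := by
  have hA : finrank F (F ⊗[E] D) = p ^ 2 := by rw [finrank_baseChange, hD]
  refine (nonempty_algEquiv_matrix_or_divisionRing hA).resolve_right ?_
  rintro ⟨Δ, _, _, ⟨e⟩⟩
  have := Algebra.IsCentral.of_algEquiv F _ _ e
  refine h Δ ((e : F ⊗[E] D →+* Δ).comp
    (Algebra.TensorProduct.includeRight : D →ₐ[E] F ⊗[E] D).toRingHom)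
    (by rw [← e.toLinearEquiv.finrank_eq, hA]) fun c => ?_
  change e (1 ⊗ₜ algebraMap E D c) = _
  rw [← e.commutes, Algebra.TensorProduct.algebraMap_apply, Algebra.algebraMap_self_apply,
    Algebra.algebraMap_eq_smul_one, Algebra.algebraMap_eq_smul_one (A := F),
    TensorProduct.tmul_smul, TensorProduct.smul_tmul']

variable [Algebra ℚ_[p] E] [FiniteDimensional ℚ_[p] E]

theorem exists_teichmuller_mul_ne_mul (hD : finrank E D = p ^ 2) :
    ∃ z y : D, ∃ s, s ≠ 0 ∧ z ^ p ^ s = z ∧ z * y ≠ y * z := by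
  have := finiteDimensional_of_finrank_sq hD
  let : Algebra ℚ_[p] D := Algebra.compHom D (algebraMap ℚ_[p] E)
  have : IsScalarTower ℚ_[p] E D := IsScalarTower.of_algebraMap_eq fun _ => rfl
  have : FiniteDimensional ℚ_[p] D := FiniteDimensional.trans ℚ_[p] E D
  let := padicNormedDivisionRing p D
  let := padicNormedAlgebra p D
  have := padic_isUltrametricDist p D
  exact exists_teichmuller_notMem_center (p := p) (exists_mul_ne_mul_of_finrank_sq hD)

theorem pow_primePow_mul_eq {M : Type*} [Monoid M] {z : M} {q s : ℕ} (h : z ^ q ^ s = z) (n : ℕ) :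
    z ^ q ^ (s * n) = z := by
  induction n with
  | zero => simp
  | succ n ih => rw [mul_add_one, pow_add, pow_mul, ih, h]

theorem nonempty_algEquiv_matrix_of_unramified (hD : finrank E D = p ^ 2) (hF : finrank E F = p)
    {a : F} {r : ℕ} (hr : r ≠ 0) (ha : a ^ p ^ r = a) (haE : a ∉ (⊥ : Subalgebra E F)) :
    Nonempty ((F ⊗[E] D) ≃ₐ[F] Matrix (Fin p) (Fin p) F) := by
  refine nonempty_algEquiv_matrix_of_forall_divisionRing hD fun Δ _ _ _ f hΔ hf => ?_
  have := finiteDimensional_of_finrank_sq hD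
  obtain ⟨z, y, s, hs, hz, hzy⟩ := exists_teichmuller_mul_ne_mul (p := p) hD
  have hzE : z ∉ (⊥ : Subalgebra E D) := by
    rintro ⟨c, rfl⟩
    exact hzy (Algebra.commutes c y)
  have hint : IsIntegral E z := Algebra.IsIntegral.isIntegral z
  have hdeg : (minpoly E z).natDegree = p := by
    let := adjoinSingletonField (F := E) z
    let zK : Algebra.adjoin E {z} := ⟨z, Algebra.self_mem_adjoin_singleton E z⟩
    have hzK : minpoly E zK = minpoly E z :=
      (minpoly.algHom_eq (Algebra.adjoin E {z}).val Subtype.val_injective zK).symm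
    have h1 := minpoly.degree_dvd (K := E) (x := zK) (Algebra.IsIntegral.isIntegral zK)
    rw [finrank_adjoin_singleton hD hzE, hzK] at h1
    refine ((Nat.dvd_prime Fact.out).mp h1).resolve_left fun h => hzE ?_
    obtain ⟨c, hc⟩ := minpoly.natDegree_eq_one_iff.mp h
    exact ⟨c, hc⟩
  have hsplit := splits_of_dvd_X_pow_sub_X (p := p) hF (mul_ne_zero hr hs)
    (pow_primePow_mul_eq ha s) haE (minpoly.monic hint) (minpoly.irreducible hint) hdeg
    (minpoly.dvd E z (by simp [mul_comm r s, pow_primePow_mul_eq hz r]))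
  have := finiteDimensional_of_finrank_sq hΔ
  let := adjoinSingletonField (F := F) (f z)
  let w : Algebra.adjoin F {f z} := ⟨f z, Algebra.self_mem_adjoin_singleton F (f z)⟩
  have hroot : Polynomial.aeval w ((minpoly E z).map (algebraMap E F)) = 0 := by
    refine Subtype.val_injective ?_
    change (Algebra.adjoin F {f z}).val _ = (Algebra.adjoin F {f z}).val 0
    rw [← Polynomial.aeval_algHom_apply, Polynomial.aeval_def, Polynomial.eval₂_map]
    have hcomp : (algebraMap F Δ).comp (algebraMap E F) = f.comp (algebraMap E D) :=
      RingHom.ext fun c => (hf c).symm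
    change Polynomial.eval₂ _ (f z) _ = _
    rw [hcomp, ← Polynomial.hom_eval₂, ← Polynomial.aeval_def, minpoly.aeval, map_zero, map_zero]
  obtain ⟨c, hc⟩ : w ∈ (algebraMap F (Algebra.adjoin F {f z})).range := by
    refine hsplit.mem_range_of_isRoot ?_ ?_
    · exact (Polynomial.map_ne_zero (minpoly.ne_zero hint))
    · rwa [Polynomial.IsRoot.def, Polynomial.eval_map_algebraMap]
  have hc' : algebraMap F Δ c = f z := congrArg Subtype.val hc
  apply hzy
  apply f.injective
  rw [map_mul, map_mul, ← hc', Algebra.commutes]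

variable [Algebra ℚ_[p] F] [FiniteDimensional ℚ_[p] F] [IsScalarTower ℚ_[p] E F]

theorem nonempty_algEquiv_matrix_of_ramified (hD : finrank E D = p ^ 2)
    (hram : ∀ c : E, c ≠ 0 → ∃ t : F, divisionNorm p (algebraMap E F c) = divisionNorm p t ^ p) :
    Nonempty ((F ⊗[E] D) ≃ₐ[F] Matrix (Fin p) (Fin p) F) := by
  refine nonempty_algEquiv_matrix_of_forall_divisionRing hD fun Δ _ _ _ f hΔ hf => ?_
  let : Algebra ℚ_[p] Δ := Algebra.compHom Δ (algebraMap ℚ_[p] F)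
  have : IsScalarTower ℚ_[p] F Δ := IsScalarTower.of_algebraMap_eq fun _ => rfl
  exact false_of_ramified_scalar_extension hD hram hΔ f hf

end Splitting

section ValueGroup

variable {p : ℕ} [Fact p.Prime]

theorem divisionNorm_zpow {K : Type*} [DivisionRing K] [Algebra ℚ_[p] K]
    [FiniteDimensional ℚ_[p] K] (x : K) (j : ℤ) :
    divisionNorm p (x ^ j) = divisionNorm p x ^ j := by
  let := padicNormedDivisionRing p K
  exact norm_zpow x j

theorem divisionNorm_pow {K : Type*} [DivisionRing K] [Algebra ℚ_[p] K]
    [FiniteDimensional ℚ_[p] K] (x : K) (j : ℕ) :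
    divisionNorm p (x ^ j) = divisionNorm p x ^ j := by
  simpa using divisionNorm_zpow (p := p) x j

theorem divisionNorm_ne_zero {K : Type*} [DivisionRing K] [Algebra ℚ_[p] K]
    [FiniteDimensional ℚ_[p] K] {x : K} (hx : x ≠ 0) : divisionNorm p x ≠ 0 :=
  fun h => hx (eq_zero_of_divisionNorm_eq_zero p h)

theorem divisionNorm_pos {K : Type*} [DivisionRing K] [Algebra ℚ_[p] K]
    [FiniteDimensional ℚ_[p] K] {x : K} (hx : x ≠ 0) : 0 < divisionNorm p x :=
  (divisionNorm_nonneg p x).lt_of_ne' (divisionNorm_ne_zero hx)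

variable (p) in
theorem exists_divisionNorm_generator (K : Type*) [DivisionRing K] [Algebra ℚ_[p] K]
    [FiniteDimensional ℚ_[p] K] : ∃ ϖ : K, ϖ ≠ 0 ∧ divisionNorm p ϖ < 1 ∧
      (∀ x : K, divisionNorm p x < 1 → divisionNorm p x ≤ divisionNorm p ϖ) ∧
      ∀ x : K, x ≠ 0 → ∃ j : ℤ, divisionNorm p x = divisionNorm p ϖ ^ j := by
  let := padicNormedDivisionRing p K
  let := padicNormedAlgebra p K
  have := padic_isUltrametricDist p K
  exact exists_uniformizer p K

variable {E F : Type*} [Field E] [Field F] [Algebra ℚ_[p] E] [FiniteDimensional ℚ_[p] E]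
  [Algebra ℚ_[p] F] [FiniteDimensional ℚ_[p] F] [Algebra E F] [IsScalarTower ℚ_[p] E F]

omit [FiniteDimensional ℚ_[p] E] [FiniteDimensional ℚ_[p] F] in
theorem divisionNorm_algebraMap_tower (c : E) :
    divisionNorm p (algebraMap E F c) = divisionNorm p c :=
  divisionNorm_algHom p (IsScalarTower.toAlgHom ℚ_[p] E F) c

variable (E) in
theorem divisionNorm_pow_finrank_eq (x : F) :
    divisionNorm p x ^ finrank E F = divisionNorm p (Algebra.norm E x) := by
  have := FiniteDimensional.right ℚ_[p] E F
  refine (pow_left_inj₀ (pow_nonneg (divisionNorm_nonneg p _) _) (divisionNorm_nonneg p _)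
    (finrank_pos (R := ℚ_[p]) (M := E)).ne').mp ?_
  rw [← pow_mul, mul_comm, finrank_mul_finrank, divisionNorm_pow_finrank, divisionNorm_pow_finrank,
    Algebra.norm_norm]

theorem exists_divisionNorm_eq_pow {ϖ : E} (hϖ0 : ϖ ≠ 0)
    (hϖ : ∀ c : E, c ≠ 0 → ∃ j : ℤ, divisionNorm p c = divisionNorm p ϖ ^ j) {x : F} {j : ℤ}
    (hj : ¬ (p : ℤ) ∣ j) (hx : divisionNorm p x ^ p = divisionNorm p ϖ ^ j) (c : E) (hc : c ≠ 0) :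
    ∃ t : F, divisionNorm p (algebraMap E F c) = divisionNorm p t ^ p := by
  obtain ⟨i, hi⟩ := hϖ c hc
  have hcop : IsCoprime (p : ℤ) j :=
    (Nat.prime_iff_prime_int.mp Fact.out).coprime_iff_not_dvd.mpr hj
  obtain ⟨a, b, hab⟩ := hcop
  have h0 := divisionNorm_ne_zero (p := p) hϖ0
  refine ⟨(algebraMap E F ϖ ^ a * x ^ b) ^ i, ?_⟩
  rw [divisionNorm_algebraMap_tower, hi, divisionNorm_zpow, divisionNorm_mul, divisionNorm_zpow,
    divisionNorm_zpow, divisionNorm_algebraMap_tower, ← zpow_natCast, ← zpow_mul, mul_comm i,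
    zpow_mul]
  congr 1
  rw [mul_zpow, ← zpow_mul _ b, mul_comm b, zpow_mul _ _ b, zpow_natCast (divisionNorm p x), hx,
    ← zpow_mul, ← zpow_mul, ← zpow_add₀ h0, mul_comm j, hab, zpow_one]

omit [FiniteDimensional ℚ_[p] E] in
/-- A finite extension of a `p`-adic field with the same value group which is generated by no
Teichmüller element is trivial. -/
theorem algebraMap_surjective_of_unramified
    (hv : ∀ x : F, x ≠ 0 → ∃ c : E, divisionNorm p c = divisionNorm p x)
    (hT : ∀ (a : F) (r : ℕ), r ≠ 0 → a ^ p ^ r = a → a ∈ (⊥ : Subalgebra E F)) :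
    Function.Surjective (algebraMap E F) := by
  let := padicNormedDivisionRing p F
  let := padicNormedAlgebra p F
  have := padic_isUltrametricDist p F
  have htop := subalgebra_eq_top_of_approx ((⊥ : Subalgebra E F).restrictScalars ℚ_[p])
    (fun x hx => by
      obtain ⟨c, hc⟩ := hv x hx
      exact ⟨algebraMap E F c, Subalgebra.algebraMap_mem _ c,
        (divisionNorm_algebraMap_tower c).trans hc⟩)
    (fun u hu => by
      obtain ⟨s, hs, hus⟩ := exists_norm_pow_primePow_sub_lt_one p hu.le
      obtain ⟨z, hz, hzu⟩ := exists_teichmuller hu.le hs hus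
      exact ⟨z, hT z s hs hz, hzu⟩)
  intro x
  have hx : x ∈ (⊥ : Subalgebra E F).restrictScalars ℚ_[p] := htop ▸ Algebra.mem_top
  exact hx

/-- An extension of degree `p` of a `p`-adic field splits every central division algebra of
degree `p`. -/
theorem nonempty_algEquiv_matrix_of_finrank_eq (hF : finrank E F = p) {D : Type*} [DivisionRing D]
    [Algebra E D] [Algebra.IsCentral E D] (hD : finrank E D = p ^ 2) :
    Nonempty ((F ⊗[E] D) ≃ₐ[F] Matrix (Fin p) (Fin p) F) := by
  by_cases hT : ∀ (a : F) (r : ℕ), r ≠ 0 → a ^ p ^ r = a → a ∈ (⊥ : Subalgebra E F)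
  swap
  · push Not at hT
    obtain ⟨a, r, hr, ha, haE⟩ := hT
    exact nonempty_algEquiv_matrix_of_unramified hD hF hr ha haE
  have := FiniteDimensional.right ℚ_[p] E F
  obtain ⟨x, hx0, hx⟩ : ∃ x : F, x ≠ 0 ∧ ∀ c : E, divisionNorm p c ≠ divisionNorm p x := by
    by_contra! hv
    have hs := algebraMap_surjective_of_unramified hv hT
    have h1 : finrank E F = 1 := Algebra.finrank_eq_one_iff_bijective_algebraMap.mpr
      ⟨(algebraMap E F).injective, hs⟩
    exact (Fact.out : p.Prime).ne_one (hF.symm.trans h1)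
  obtain ⟨ϖ, hϖ0, -, -, hϖ⟩ := exists_divisionNorm_generator p E
  obtain ⟨j, hj⟩ := hϖ (Algebra.norm E x) (Algebra.norm_ne_zero_iff.mpr hx0)
  rw [← divisionNorm_pow_finrank_eq, hF] at hj
  refine nonempty_algEquiv_matrix_of_ramified hD
    (exists_divisionNorm_eq_pow hϖ0 hϖ (x := x) (j := j) ?_ hj)
  rintro ⟨i, rfl⟩
  refine hx (ϖ ^ i) ?_
  rw [divisionNorm_zpow]
  refine (pow_left_inj₀ (zpow_nonneg (divisionNorm_nonneg p _) _) (divisionNorm_nonneg p _)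
    (Fact.out : p.Prime).ne_zero).mp ?_
  rw [hj, mul_comm, zpow_mul, zpow_natCast]

end ValueGroup

section BaseChange

variable {p : ℕ} [Fact p.Prime] {E E' F : Type*} [Field E] [Field E'] [Field F]
  [Algebra ℚ_[p] E'] [FiniteDimensional ℚ_[p] E']
  [Algebra ℚ_[p] F] [FiniteDimensional ℚ_[p] F] [Algebra E E'] [Algebra E F] [Algebra E' F]
  [IsScalarTower E E' F] [IsScalarTower ℚ_[p] E' F]

/-- If `F` has degree `p` over an intermediate field `E'` between `E` and `F`, then `F` splits
every central division algebra of degree `p` over `E`. -/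
theorem nonempty_algEquiv_matrix_of_finrank_eq_intermediate (hF : finrank E' F = p)
    {D : Type*} [DivisionRing D] [Algebra E D] [Algebra.IsCentral E D] (hD : finrank E D = p ^ 2) :
    Nonempty ((F ⊗[E] D) ≃ₐ[F] Matrix (Fin p) (Fin p) F) := by
  have hA : finrank E' (E' ⊗[E] D) = p ^ 2 := by rw [finrank_baseChange, hD]
  let ι : D →ₐ[E] E' ⊗[E] D := Algebra.TensorProduct.includeRight
  rcases nonempty_algEquiv_matrix_or_divisionRing hA with ⟨⟨e⟩⟩ | ⟨Δ, _, _, ⟨e⟩⟩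
  · exact nonempty_scalarExtension_algEquiv_matrix hD
      (((IsScalarTower.toAlgHom E E' F).mapMatrix.comp (e.toAlgHom.restrictScalars E)).comp ι)
  · have := Algebra.IsCentral.of_algEquiv E' _ _ e
    have hΔ : finrank E' Δ = p ^ 2 := by rw [← e.toLinearEquiv.finrank_eq, hA]
    obtain ⟨g⟩ := nonempty_algEquiv_matrix_of_finrank_eq (p := p) hF hΔ
    let h : E' ⊗[E] D →ₐ[E'] Matrix (Fin p) (Fin p) F :=
      ((g.toAlgHom.restrictScalars E').comp
        ((Algebra.TensorProduct.includeRight : Δ →ₐ[E'] F ⊗[E'] Δ))).comp e.toAlgHom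
    exact nonempty_scalarExtension_algEquiv_matrix hD ((h.restrictScalars E).comp ι)

end BaseChange

section PrimePowers

theorem norm_sub_one_pow_eq (p : ℕ) [Fact p.Prime] {K : Type*} [NormedField K]
    [IsUltrametricDist K] {x b : K} (hb : ‖(p : K)‖ < ‖b‖) (hb1 : ‖b‖ ≤ 1) (hx : x ^ p = 1 + b) :
    ‖x - 1‖ ^ p = ‖b‖ := by
  have hp : p.Prime := Fact.out
  have hx1 : ‖x‖ ≤ 1 := by
    refine (pow_le_one_iff_of_nonneg (norm_nonneg x) hp.ne_zero).mp ?_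
    rw [← norm_pow, hx]
    exact (IsUltrametricDist.norm_add_le_max _ _).trans (max_le norm_one.le hb1)
  have hy1 : ‖x - 1‖ ≤ 1 := (norm_sub_le_max _ _).trans (max_le hx1 norm_one.le)
  have h := add_pow_prime_eq hp (x - 1) 1
  rw [sub_add_cancel, hx] at h
  set r := ∑ k ∈ Finset.Ioo 0 p, (x - 1) ^ (k - 1) * 1 ^ (p - k - 1) * ((p.choose k / p : ℕ) : K)
  have hr : ‖r‖ ≤ 1 := by
    refine IsUltrametricDist.norm_sum_le_of_forall_le_of_nonneg zero_le_one fun i _ => ?_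
    rw [one_pow, mul_one, norm_mul, norm_pow]
    exact mul_le_one₀ (pow_le_one₀ (norm_nonneg _) hy1) (norm_nonneg _)
      (IsUltrametricDist.norm_natCast_le_one K _)
  rw [← norm_pow]
  refine norm_eq_of_norm_sub_lt (lt_of_le_of_lt ?_ hb)
  have : (x - 1) ^ p - b = -(p * ((x - 1) * r)) := by linear_combination -h
  rw [this, norm_neg, norm_mul, norm_mul]
  exact mul_le_of_le_one_right (norm_nonneg _) (mul_le_one₀ hy1 (norm_nonneg _) hr)

variable {p : ℕ} [Fact p.Prime] {K : Type*} [Field K] [Algebra ℚ_[p] K] [FiniteDimensional ℚ_[p] K]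

theorem pow_prime_mul_one_add_pow_ne {ϖ : K} (hϖ1 : divisionNorm p ϖ < 1)
    (hϖ : ∀ c : K, c ≠ 0 → ∃ j : ℤ, divisionNorm p c = divisionNorm p ϖ ^ j)
    {i j : ℕ} (hi : ¬ p ∣ i) (hij : i < j)
    (hpi : divisionNorm p (p : K) < divisionNorm p ϖ ^ i) (x : K) :
    x ^ p * (1 + ϖ ^ j) ≠ 1 + ϖ ^ i := by
  let := padicNormedField p K
  let := padicNormedAlgebra p K
  have := padic_isUltrametricDist p K
  change ‖ϖ‖ < 1 at hϖ1
  change ∀ c : K, c ≠ 0 → ∃ j : ℤ, ‖c‖ = ‖ϖ‖ ^ j at hϖ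
  change ‖(p : K)‖ < ‖ϖ‖ ^ i at hpi
  intro hx
  have hi0 : i ≠ 0 := fun h => hi (h ▸ dvd_zero p)
  have hϖ0 : 0 < ‖ϖ‖ := by
    refine norm_pos_iff.mpr fun h => ?_
    rw [h, norm_zero, zero_pow hi0] at hpi
    exact (norm_nonneg _).not_gt hpi
  have hj1 : ‖1 + ϖ ^ j‖ = 1 := by
    refine (norm_eq_of_norm_sub_lt (y := (1 : K)) ?_).trans norm_one
    rw [add_sub_cancel_left, norm_one, norm_pow]
    exact pow_lt_one₀ hϖ0.le hϖ1 (by omega)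
  have hj0 : 1 + ϖ ^ j ≠ 0 := norm_ne_zero_iff.mp (by rw [hj1]; exact one_ne_zero)
  have hij' : ‖ϖ ^ i - ϖ ^ j‖ = ‖ϖ‖ ^ i := by
    rw [← norm_pow]
    refine norm_eq_of_norm_sub_lt ?_
    rw [sub_sub_cancel_left, norm_neg, norm_pow, norm_pow]
    exact pow_lt_pow_right_of_lt_one₀ hϖ0 hϖ1 hij
  have hb : ‖(ϖ ^ i - ϖ ^ j) / (1 + ϖ ^ j)‖ = ‖ϖ‖ ^ i := by rw [norm_div, hj1, div_one, hij']
  have hxb : x ^ p = 1 + (ϖ ^ i - ϖ ^ j) / (1 + ϖ ^ j) := by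
    field_simp
    rw [hx]
    ring
  have h := norm_sub_one_pow_eq p (by rwa [hb]) (by rw [hb]; exact pow_le_one₀ hϖ0.le hϖ1.le) hxb
  rw [hb] at h
  have hx1 : x - 1 ≠ 0 := fun h0 => by
    rw [h0, norm_zero, zero_pow (Fact.out : p.Prime).ne_zero] at h
    exact (pow_pos hϖ0 i).ne h
  obtain ⟨s, hs⟩ := hϖ _ hx1
  rw [hs, ← zpow_natCast, ← zpow_mul, ← zpow_natCast, zpow_right_inj₀ hϖ0 hϖ1.ne] at h
  exact hi (Int.natCast_dvd_natCast.mp ⟨s, by rw [← h, mul_comm]⟩)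

theorem pow_prime_mul_one_add_pow_ne_of_ne {ϖ : K} (hϖ1 : divisionNorm p ϖ < 1)
    (hϖ : ∀ c : K, c ≠ 0 → ∃ j : ℤ, divisionNorm p c = divisionNorm p ϖ ^ j)
    {i j : ℕ} (hi : ¬ p ∣ i) (hj : ¬ p ∣ j) (hij : i ≠ j)
    (hpi : divisionNorm p (p : K) < divisionNorm p ϖ ^ i)
    (hpj : divisionNorm p (p : K) < divisionNorm p ϖ ^ j) {x : K} (hx : x ≠ 0) :
    x ^ p * (1 + ϖ ^ j) ≠ 1 + ϖ ^ i := by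
  rcases hij.lt_or_gt with h | h
  · exact pow_prime_mul_one_add_pow_ne hϖ1 hϖ hi h hpi x
  · intro hxe
    refine pow_prime_mul_one_add_pow_ne hϖ1 hϖ hj h hpj x⁻¹ ?_
    rw [← hxe, inv_pow, inv_mul_cancel_left₀ (pow_ne_zero p hx)]

end PrimePowers

section Pigeonhole

theorem exists_forall_pow_prime_ne {p n : ℕ} [Fact p.Prime] {L K : Type*} [Field L] [Field K]
    [Algebra L K] [IsGalois L K] (T : IntermediateField L K) [FiniteDimensional L T]
    (hT : finrank L T ≤ n) (a : Fin (p ^ n + 1) → L) (ha0 : ∀ i, a i ≠ 0)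
    (ha : ∀ i j, i ≠ j → ∀ x : L, x ≠ 0 → x ^ p * a j ≠ a i) :
    ∃ j, ∀ x ∈ T, x ^ p ≠ algebraMap L K (a j) := by
  have hp : p.Prime := Fact.out
  classical
  have : NeZero p := ⟨hp.ne_zero⟩
  have : Fintype (T →ₐ[L] K) := Fintype.ofFinite _
  have : Fintype (rootsOfUnity p K) := Fintype.ofFinite _
  by_contra! h
  choose α hαT hα using h
  have hα0 : ∀ i, α i ≠ 0 := fun i h0 => ha0 i <| (algebraMap L K).injective <| by
    rw [← hα, h0, zero_pow hp.ne_zero, map_zero]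
  let Φ : Fin (p ^ n + 1) → (T →ₐ[L] K) → rootsOfUnity p K := fun i σ =>
    rootsOfUnity.mkOfPowEq (σ ⟨α i, hαT i⟩ / α i) (by
      have h1 : (⟨α i, hαT i⟩ : T) ^ p = algebraMap L T (a i) := Subtype.ext (hα i)
      rw [div_pow, ← map_pow, h1, AlgHom.commutes, hα,
        div_self ((map_ne_zero (algebraMap L K)).mpr (ha0 i))])
  have hcard : Fintype.card ((T →ₐ[L] K) → rootsOfUnity p K) < Fintype.card (Fin (p ^ n + 1)) := by
    rw [Fintype.card_fun, Fintype.card_fin, Nat.lt_succ_iff, ← Nat.card_eq_fintype_card]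
    calc _ ≤ p ^ Fintype.card (T →ₐ[L] K) := Nat.pow_le_pow_left (card_rootsOfUnity K p) _
      _ ≤ p ^ n := Nat.pow_le_pow_right hp.pos ?_
    exact le_trans (by rw [← Nat.card_eq_fintype_card]; exact (card_algHom_le_finrank L T K)) hT
  obtain ⟨i, j, hij, hΦ⟩ := Fintype.exists_ne_map_eq_of_card_lt Φ hcard
  have hfix : α i / α j ∈ (⊥ : IntermediateField L K) := by
    rw [InfiniteGalois.mem_bot_iff_fixed]
    intro τ
    have h1 := congrArg (fun u : rootsOfUnity p K => ((u : Kˣ) : K))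
      (congrFun hΦ ((τ : K →ₐ[L] K).comp T.val))
    have h2 : τ (α i) / α i = τ (α j) / α j := h1
    rw [map_div₀, div_eq_div_iff ((map_ne_zero τ).mpr (hα0 j)) (hα0 j)]
    rw [div_eq_div_iff (hα0 i) (hα0 j)] at h2
    rw [h2, mul_comm]
  obtain ⟨x, hx⟩ := hfix
  have hx' : algebraMap L K x = α i / α j := hx
  refine ha i j hij x ?_ ?_
  · rintro rfl
    rw [map_zero] at hx'
    exact div_ne_zero (hα0 i) (hα0 j) hx'.symm
  · apply (algebraMap L K).injective
    rw [map_mul, map_pow, hx', div_pow, hα, hα, div_mul_cancel₀]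
    exact (map_ne_zero (algebraMap L K)).mpr (ha0 j)

end Pigeonhole

section RadicalExtensions

variable {p : ℕ} [Fact p.Prime] {k : Type*} [Field k] [Algebra ℚ_[p] k] [FiniteDimensional ℚ_[p] k]

section

variable {F : Type*} [Field F] [Algebra ℚ_[p] F] [FiniteDimensional ℚ_[p] F] [Algebra k F]
  [IsScalarTower ℚ_[p] k F] {π : k} (hπ0 : π ≠ 0) (hπ1 : divisionNorm p π < 1)
  (hπ : ∀ c : k, c ≠ 0 → ∃ j : ℤ, divisionNorm p c = divisionNorm p π ^ j)
  {ϖ : F} {m : ℕ} (hϖ : ϖ ^ m = algebraMap k F π)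

include hπ0 hπ1 hπ hϖ

theorem dvd_finrank_of_pow_eq : m ∣ finrank k F := by
  have := FiniteDimensional.right ℚ_[p] k F
  rcases eq_or_ne m 0 with rfl | hm
  · rw [pow_zero, ← map_one (algebraMap k F)] at hϖ
    rw [← (algebraMap k F).injective hϖ, divisionNorm_one] at hπ1
    exact (lt_irrefl _ hπ1).elim
  have hϖ0 : ϖ ≠ 0 := fun h => by
    rw [h, zero_pow hm, eq_comm, map_eq_zero] at hϖ
    exact hπ0 hϖ
  obtain ⟨j, hj⟩ := hπ _ (Algebra.norm_ne_zero_iff (R := k).mpr hϖ0)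
  rw [← divisionNorm_pow_finrank_eq] at hj
  have h1 : divisionNorm p ϖ ^ m = divisionNorm p π := by
    rw [← divisionNorm_pow, hϖ, divisionNorm_algebraMap_tower]
  have h2 : divisionNorm p π ^ (finrank k F : ℤ) = divisionNorm p π ^ (j * m) := by
    rw [zpow_natCast, zpow_mul, ← hj, ← h1, zpow_natCast, ← pow_mul, ← pow_mul, mul_comm m]
  rw [zpow_right_inj₀ (divisionNorm_pos hπ0) hπ1.ne] at h2
  exact Int.natCast_dvd_natCast.mp ⟨j, by rw [h2, mul_comm]⟩

omit hπ0 hπ1 in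
theorem exists_divisionNorm_eq_zpow_of_pow_eq (hm : finrank k F = m) (x : F) (hx : x ≠ 0) :
    ∃ j : ℤ, divisionNorm p x = divisionNorm p ϖ ^ j := by
  have := FiniteDimensional.right ℚ_[p] k F
  have hm0 : m ≠ 0 := hm ▸ finrank_pos.ne'
  obtain ⟨j, hj⟩ := hπ _ (Algebra.norm_ne_zero_iff (R := k).mpr hx)
  refine ⟨j, ?_⟩
  rw [← divisionNorm_pow_finrank_eq, hm, ← divisionNorm_algebraMap_tower (E := k) (F := F),
    ← hϖ, divisionNorm_pow, ← zpow_natCast, ← zpow_natCast, ← zpow_mul, mul_comm, zpow_mul] at hj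
  rw [zpow_natCast, zpow_natCast] at hj
  exact (pow_left_inj₀ (divisionNorm_nonneg p _) (zpow_nonneg (divisionNorm_nonneg p _) _)
    hm0).mp hj

end

theorem finrank_adjoin_simple_le_of_pow_eq {L K : Type*} [Field L] [Field K] [Algebra L K] {x : K}
    {a : L} {m : ℕ} (hm : m ≠ 0) (hx : x ^ m = algebraMap L K a) :
    FiniteDimensional L (IntermediateField.adjoin L {x}) ∧
      finrank L (IntermediateField.adjoin L {x}) ≤ m := by
  have hmonic := Polynomial.monic_X_pow_sub_C a hm
  have hroot : Polynomial.aeval x (Polynomial.X ^ m - Polynomial.C a) = 0 := by simp [hx]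
  have hint : IsIntegral L x := ⟨_, hmonic, hroot⟩
  refine ⟨IntermediateField.adjoin.finiteDimensional hint, ?_⟩
  rw [IntermediateField.adjoin.finrank hint]
  refine (Polynomial.natDegree_le_of_dvd (minpoly.dvd L x hroot) hmonic.ne_zero).trans_eq ?_
  exact Polynomial.natDegree_X_pow_sub_C

theorem finrank_adjoin_simple_eq_of_pow_prime_eq {L K : Type*} [Field L] [Field K] [Algebra L K]
    {x : K} {a : L} (hx : x ^ p = algebraMap L K a) (ha : ∀ b : L, b ^ p ≠ a) :
    finrank L (IntermediateField.adjoin L {x}) = p := by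
  have hp : p.Prime := Fact.out
  have hmonic := Polynomial.monic_X_pow_sub_C a hp.ne_zero
  have hroot : Polynomial.aeval x (Polynomial.X ^ p - Polynomial.C a) = 0 := by simp [hx]
  rw [IntermediateField.adjoin.finrank ⟨_, hmonic, hroot⟩,
    ← minpoly.eq_of_irreducible_of_monic (X_pow_sub_C_irreducible_of_prime hp ha) hroot hmonic,
    Polynomial.natDegree_X_pow_sub_C]

variable {K : Type*} [Field K] [Algebra k K] {π : k}

theorem finrank_adjoin_simple_eq_of_pow_eq (hπ0 : π ≠ 0) (hπ1 : divisionNorm p π < 1)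
    (hπ : ∀ c : k, c ≠ 0 → ∃ j : ℤ, divisionNorm p c = divisionNorm p π ^ j) {ϖ : K} {m : ℕ}
    (hm : m ≠ 0) (hϖ : ϖ ^ m = algebraMap k K π) :
    finrank k (IntermediateField.adjoin k {ϖ}) = m := by
  obtain ⟨h1, h2⟩ := finrank_adjoin_simple_le_of_pow_eq hm hϖ
  let : Algebra ℚ_[p] (IntermediateField.adjoin k {ϖ}) :=
    Algebra.compHom _ (algebraMap ℚ_[p] k)
  have : IsScalarTower ℚ_[p] k (IntermediateField.adjoin k {ϖ}) :=
    IsScalarTower.of_algebraMap_eq fun _ => rfl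
  have := FiniteDimensional.trans ℚ_[p] k (IntermediateField.adjoin k {ϖ})
  refine le_antisymm h2 (Nat.le_of_dvd finrank_pos ?_)
  exact dvd_finrank_of_pow_eq hπ0 hπ1 hπ
    (ϖ := ⟨ϖ, IntermediateField.mem_adjoin_simple_self k ϖ⟩) (Subtype.ext hϖ)

end RadicalExtensions

section Compositum

theorem finiteDimensional_of_productMap_surjective {k E M F : Type*} [Field k] [Field E] [Field M]
    [Field F] [Algebra k E] [Algebra k M] [Algebra k F] [FiniteDimensional k E]
    [FiniteDimensional k M] {f : M →ₐ[k] F} {g : E →ₐ[k] F}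
    (h : Function.Surjective (Algebra.TensorProduct.productMap f g)) : FiniteDimensional k F :=
  Module.Finite.of_surjective (Algebra.TensorProduct.productMap f g).toLinearMap h

theorem exists_algEquiv_matrix_of_ramified_radical {p : ℕ} [Fact p.Prime] {k E F D : Type*}
    [Field k] [Algebra ℚ_[p] k] [FiniteDimensional ℚ_[p] k] [Field E] [Algebra k E]
    [FiniteDimensional k E] [Field F] [Algebra k F] [Algebra E F] [IsScalarTower k E F]
    [FiniteDimensional k F] [DivisionRing D] [Algebra E D] [Algebra.IsCentral E D]
    (hD : finrank E D = p ^ 2) {π : k} {ϖ : F} {a : ℕ} (hϖ : ϖ ^ p ^ (a + 1) = algebraMap k F π)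
    [Algebra ℚ_[p] E] [IsScalarTower ℚ_[p] k E]
    {ϖE : E} (hϖE0 : ϖE ≠ 0)
    (hϖE : ∀ c : E, c ≠ 0 → ∃ j : ℤ, divisionNorm p c = divisionNorm p ϖE ^ j) {b : ℤ}
    (hb : ¬ (p : ℤ) ∣ b) (hab : divisionNorm p π = divisionNorm p ϖE ^ ((p : ℤ) ^ a * b)) :
    Nonempty ((F ⊗[E] D) ≃ₐ[F] Matrix (Fin p) (Fin p) F) := by
  have hp : p.Prime := Fact.out
  have : FiniteDimensional ℚ_[p] E := FiniteDimensional.trans ℚ_[p] k E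
  let : Algebra ℚ_[p] F := Algebra.compHom F (algebraMap ℚ_[p] k)
  have : IsScalarTower ℚ_[p] k F := IsScalarTower.of_algebraMap_eq fun _ => rfl
  have : FiniteDimensional ℚ_[p] F := FiniteDimensional.trans ℚ_[p] k F
  have : IsScalarTower ℚ_[p] E F := IsScalarTower.to₁₃₄ ℚ_[p] k E F
  refine nonempty_algEquiv_matrix_of_ramified hD
    (exists_divisionNorm_eq_pow hϖE0 hϖE (x := ϖ) hb ?_)
  refine (pow_left_inj₀ (pow_nonneg (divisionNorm_nonneg p _) _)
    (zpow_nonneg (divisionNorm_nonneg p _) _) (pow_ne_zero a hp.ne_zero)).mp ?_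
  rw [← pow_mul, ← pow_succ', ← divisionNorm_pow, hϖ, divisionNorm_algebraMap_tower, hab,
    ← zpow_natCast, ← zpow_mul, mul_comm, Nat.cast_pow]

end Compositum

theorem exists_splitting_of_ne {p : ℕ} [Fact p.Prime] {k : Type} [Field k]
    [Algebra ℚ_[p] k] [FiniteDimensional ℚ_[p] k] {E : Type} [Field E] [Algebra k E]
    [FiniteDimensional k E] {D : Type} [DivisionRing D] [Algebra E D] [Algebra.IsCentral E D]
    (hD : finrank E D = p ^ 2) {ℓ : ℕ} (hℓ : ℓ.Prime) (hℓp : ℓ ≠ p) :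
    ∃ (L : IntermediateField k (AlgebraicClosure k))
      (M : IntermediateField L (AlgebraicClosure k)),
      FiniteDimensional k L ∧ Nat.Coprime (finrank k L) ℓ ∧
      FiniteDimensional (↥L) (↥M) ∧ finrank (↥L) (↥M) = p ∧
      CSASplitsOver k E D p M := by
  have hp : p.Prime := Fact.out
  obtain ⟨π, hπ0, hπ1, -, hπ⟩ := exists_divisionNorm_generator p k
  let : Algebra ℚ_[p] E := Algebra.compHom E (algebraMap ℚ_[p] k)
  have : IsScalarTower ℚ_[p] k E := IsScalarTower.of_algebraMap_eq fun _ => rfl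
  have : FiniteDimensional ℚ_[p] E := FiniteDimensional.trans ℚ_[p] k E
  obtain ⟨ϖE, hϖE0, -, -, hϖE⟩ := exists_divisionNorm_generator p E
  obtain ⟨e, he⟩ := hϖE (algebraMap k E π) ((map_ne_zero _).mpr hπ0)
  rw [divisionNorm_algebraMap_tower] at he
  have he0 : e ≠ 0 := by
    rintro rfl
    rw [zpow_zero] at he
    exact hπ1.ne he
  obtain ⟨b, hab, hb⟩ := (Int.finiteMultiplicity_iff (a := (p : ℤ)).mpr
    ⟨by simpa using hp.ne_one, he0⟩).exists_eq_pow_mul_and_not_dvd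
  set a := multiplicity (p : ℤ) e
  rw [hab] at he
  let K := AlgebraicClosure k
  obtain ⟨ϖ, hϖ⟩ := IsAlgClosed.exists_pow_nat_eq (algebraMap k K π) (pow_pos hp.pos (a + 1))
  have hϖp : (ϖ ^ p) ^ p ^ a = algebraMap k K π := by rw [← pow_mul, ← pow_succ', hϖ]
  let L := IntermediateField.adjoin k {ϖ ^ p}
  have hL : FiniteDimensional k L :=
    (finrank_adjoin_simple_le_of_pow_eq (pow_ne_zero a hp.ne_zero) hϖp).1
  have hLa : finrank k L = p ^ a :=
    finrank_adjoin_simple_eq_of_pow_eq hπ0 hπ1 hπ (pow_ne_zero a hp.ne_zero) hϖp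
  let x : L := ⟨ϖ ^ p, IntermediateField.mem_adjoin_simple_self k _⟩
  let M := IntermediateField.adjoin L {ϖ}
  obtain ⟨hM, hMp⟩ := finrank_adjoin_simple_le_of_pow_eq (L := L) (a := x) (x := ϖ) hp.ne_zero rfl
  let ϖM : M := ⟨ϖ, IntermediateField.mem_adjoin_simple_self L ϖ⟩
  have hϖM : ϖM ^ p ^ (a + 1) = algebraMap k M π := Subtype.ext hϖ
  have hkM : FiniteDimensional k M := FiniteDimensional.trans k L M
  refine ⟨L, M, hL, ?_, hM, ?_, ?_⟩
  · rw [hLa]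
    exact Nat.Coprime.pow_left a ((Nat.coprime_primes hp hℓ).mpr hℓp.symm)
  · let : Algebra ℚ_[p] M := Algebra.compHom M (algebraMap ℚ_[p] k)
    have : IsScalarTower ℚ_[p] k M := IsScalarTower.of_algebraMap_eq fun _ => rfl
    have := FiniteDimensional.trans ℚ_[p] k M
    have h := dvd_finrank_of_pow_eq hπ0 hπ1 hπ hϖM
    rw [← finrank_mul_finrank k L M, hLa, pow_succ] at h
    exact le_antisymm hMp (Nat.le_of_dvd finrank_pos
      (Nat.dvd_of_mul_dvd_mul_left (pow_pos hp.pos a) h))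
  · intro F _ _ _ _ _ _ hsurj
    have := finiteDimensional_of_productMap_surjective hsurj
    exact exists_algEquiv_matrix_of_ramified_radical hD (ϖ := algebraMap M F ϖM)
      (by rw [← map_pow, hϖM, ← IsScalarTower.algebraMap_apply]) hϖE0 hϖE hb he

theorem nonempty_algEquiv_matrix_of_not_pow_prime {p : ℕ} [Fact p.Prime] {k E F D L M K : Type*}
    [Field k] [Algebra ℚ_[p] k] [FiniteDimensional ℚ_[p] k] [Field E] [Algebra k E]
    [Field F] [Algebra k F] [Algebra E F] [IsScalarTower k E F]
    [FiniteDimensional k F] [DivisionRing D] [Algebra E D] [Algebra.IsCentral E D]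
    (hD : finrank E D = p ^ 2) [Field L] [Algebra k L] [Field M] [Algebra k M] [Algebra L M]
    [IsScalarTower k L M] [Algebra M F] [IsScalarTower k M F] [Field K] [IsAlgClosed K]
    [Algebra k K] [Algebra L K] [IsScalarTower k L K] (T : IntermediateField L K)
    (hT : ∀ (φ : E →ₐ[k] K) (c : E), φ c ∈ T) {a : L}
    (ha : ∀ y ∈ T, y ^ p ≠ algebraMap L K a) {α : M} (hα : α ^ p = algebraMap L M a)
    (hM : ∀ m : M, ∃ f : Polynomial L, m = Polynomial.aeval α f)
    (hsurj : Function.Surjective (Algebra.TensorProduct.productMap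
      (IsScalarTower.toAlgHom k M F) (IsScalarTower.toAlgHom k E F))) :
    Nonempty ((F ⊗[E] D) ≃ₐ[F] Matrix (Fin p) (Fin p) F) := by
  let : Algebra L F := Algebra.compHom F (algebraMap L M)
  have : IsScalarTower L M F := IsScalarTower.of_algebraMap_eq fun _ => rfl
  have : IsScalarTower k L F := IsScalarTower.to₁₂₄ k L M F
  have : Algebra.IsAlgebraic L F := Algebra.IsAlgebraic.tower_top (K := k) L
  let φ : F →ₐ[L] K := IsAlgClosed.lift
  let E' : IntermediateField E F := IntermediateField.adjoin E (Set.range (algebraMap L F))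
  have hE'T : ∀ y ∈ E', φ y ∈ T := by
    intro y hy
    induction hy using IntermediateField.adjoin_induction with
    | mem x hx =>
      obtain ⟨c, rfl⟩ := hx
      rw [AlgHom.commutes]
      exact T.algebraMap_mem c
    | algebraMap x => exact hT ((φ.restrictScalars k).comp (IsScalarTower.toAlgHom k E F)) x
    | add x y _ _ hx hy => rw [map_add]; exact add_mem hx hy
    | inv x _ hx => rw [map_inv₀]; exact inv_mem hx
    | mul x y _ _ hx hy => rw [map_mul]; exact mul_mem hx hy
  have hLE' : ∀ c : L, algebraMap L F c ∈ E' := fun c =>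
    IntermediateField.subset_adjoin _ _ ⟨c, rfl⟩
  let a' : E' := ⟨algebraMap L F a, hLE' a⟩
  have ha' : ∀ y : E', y ^ p ≠ a' := fun y hy => by
    refine ha (φ y) (hE'T y y.2) ?_
    rw [← map_pow, ← φ.commutes a]
    exact congrArg φ (congrArg Subtype.val hy)
  have hα' : (algebraMap M F α) ^ p = algebraMap E' F a' := by
    rw [← map_pow, hα, ← IsScalarTower.algebraMap_apply]
    rfl
  have hfin := finrank_adjoin_simple_eq_of_pow_prime_eq hα' ha'
  have htop : IntermediateField.adjoin E' {algebraMap M F α} = ⊤ := by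
    refine top_le_iff.mp fun x _ => ?_
    obtain ⟨y, rfl⟩ := hsurj x
    induction y with
    | zero => rw [map_zero]; exact zero_mem _
    | add x y hx hy =>
      rw [map_add]
      exact add_mem (hx trivial) (hy trivial)
    | tmul m c =>
      rw [Algebra.TensorProduct.productMap_apply_tmul]
      refine mul_mem ?_ ?_
      · obtain ⟨f, rfl⟩ := hM m
        change algebraMap M F _ ∈ _
        rw [← Polynomial.aeval_algebraMap_apply, Polynomial.aeval_eq_sum_range]
        refine sum_mem fun i _ => ?_
        rw [Algebra.smul_def]
        exact mul_mem (IntermediateField.algebraMap_mem _ (⟨_, hLE' _⟩ : E'))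
          (pow_mem (IntermediateField.mem_adjoin_simple_self _ _) i)
      · exact IntermediateField.algebraMap_mem _ (algebraMap E E' c)
  rw [htop, IntermediateField.finrank_top'] at hfin
  let : Algebra ℚ_[p] F := Algebra.compHom F (algebraMap ℚ_[p] k)
  have : IsScalarTower ℚ_[p] k F := IsScalarTower.of_algebraMap_eq fun _ => rfl
  have : FiniteDimensional ℚ_[p] F := FiniteDimensional.trans ℚ_[p] k F
  let : Algebra ℚ_[p] E := Algebra.compHom E (algebraMap ℚ_[p] k)
  have : IsScalarTower ℚ_[p] k E := IsScalarTower.of_algebraMap_eq fun _ => rfl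
  have : IsScalarTower ℚ_[p] E F := IsScalarTower.to₁₃₄ ℚ_[p] k E F
  have : IsScalarTower ℚ_[p] E' F := IsScalarTower.of_algebraMap_eq fun _ => rfl
  have : FiniteDimensional ℚ_[p] E' := FiniteDimensional.left ℚ_[p] E' F
  exact nonempty_algEquiv_matrix_of_finrank_eq_intermediate hfin hD

theorem exists_splitting_of_eq {p : ℕ} [Fact p.Prime] {k : Type} [Field k]
    [Algebra ℚ_[p] k] [FiniteDimensional ℚ_[p] k] {E : Type} [Field E] [Algebra k E]
    [FiniteDimensional k E] {D : Type} [DivisionRing D] [Algebra E D] [Algebra.IsCentral E D]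
    (hD : finrank E D = p ^ 2) :
    ∃ (L : IntermediateField k (AlgebraicClosure k))
      (M : IntermediateField L (AlgebraicClosure k)),
      FiniteDimensional k L ∧ Nat.Coprime (finrank k L) p ∧
      FiniteDimensional (↥L) (↥M) ∧ finrank (↥L) (↥M) = p ∧
      CSASplitsOver k E D p M := by
  have hp : p.Prime := Fact.out
  obtain ⟨π, hπ0, hπ1, hπmax, hπ⟩ := exists_divisionNorm_generator p k
  let K := AlgebraicClosure k
  have : CharZero k := charZero_of_injective_algebraMap (algebraMap ℚ_[p] k).injective
  let N := IntermediateField.normalClosure k E K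
  let n := finrank k N
  let m := p * (p ^ n + 1) + 1
  have hm0 : m ≠ 0 := Nat.succ_ne_zero _
  obtain ⟨ϖ, hϖ⟩ := IsAlgClosed.exists_pow_nat_eq (algebraMap k K π) (Nat.pos_of_ne_zero hm0)
  let L := IntermediateField.adjoin k {ϖ}
  have hL : FiniteDimensional k L := (finrank_adjoin_simple_le_of_pow_eq hm0 hϖ).1
  have hLm : finrank k L = m := finrank_adjoin_simple_eq_of_pow_eq hπ0 hπ1 hπ hm0 hϖ
  let x : L := ⟨ϖ, IntermediateField.mem_adjoin_simple_self k ϖ⟩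
  have hx : x ^ m = algebraMap k L π := Subtype.ext hϖ
  have : FiniteDimensional ℚ_[p] L := FiniteDimensional.trans ℚ_[p] k L
  have hxL := exists_divisionNorm_eq_zpow_of_pow_eq hπ hx hLm
  have hxm : divisionNorm p x ^ m = divisionNorm p π := by
    rw [← divisionNorm_pow, hx, divisionNorm_algebraMap_tower]
  have hx1 : divisionNorm p x < 1 :=
    (pow_lt_one_iff_of_nonneg (divisionNorm_nonneg p x) hm0).mp (hxm.trans_lt hπ1)
  have hx0 : 0 < divisionNorm p x := divisionNorm_pos fun h => by
    rw [h, divisionNorm_zero, zero_pow hm0] at hxm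
    exact divisionNorm_ne_zero hπ0 hxm.symm
  have hpx : ∀ i < m, divisionNorm p (p : L) < divisionNorm p x ^ i := fun i hi => by
    refine lt_of_le_of_lt ?_ (pow_lt_pow_right_of_lt_one₀ hx0 hx1 hi)
    rw [hxm, ← map_natCast (algebraMap k L), divisionNorm_algebraMap_tower]
    refine hπmax _ ?_
    rw [← map_natCast (algebraMap ℚ_[p] k), divisionNorm_algebraMap]
    exact Padic.norm_p_lt_one
  let T : IntermediateField L K := IntermediateField.adjoin L (N : Set K)
  have hTrank : Module.rank L T ≤ Module.rank k N :=
    IntermediateField.adjoin_rank_le_of_isAlgebraic_right L N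
  have hTfin : FiniteDimensional L T :=
    Module.rank_lt_aleph0_iff.mp (hTrank.trans_lt (Module.rank_lt_aleph0 k N))
  have hTn : finrank L T ≤ n := Cardinal.toNat_le_toNat hTrank (Module.rank_lt_aleph0 k N)
  let s : Fin (p ^ n + 1) → ℕ := fun t => p * t + 1
  have hsp : ∀ t, ¬ p ∣ s t := fun t h =>
    hp.one_lt.ne' (Nat.dvd_one.mp ((Nat.dvd_add_right (dvd_mul_right p t)).mp h))
  have hsm : ∀ t, s t < m := fun t =>
    Nat.add_lt_add_right (Nat.mul_lt_mul_of_pos_left t.2 hp.pos) 1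
  have hsinj : ∀ i j, i ≠ j → s i ≠ s j := fun i j hij h =>
    hij (Fin.ext (Nat.eq_of_mul_eq_mul_left hp.pos (Nat.add_right_cancel h)))
  obtain ⟨t, ht⟩ := exists_forall_pow_prime_ne (p := p) T hTn (fun t => 1 + x ^ s t)
    (fun t h => by
      have h1 : x ^ s t = -1 := by linear_combination h
      have h2 := congrArg (divisionNorm p) h1
      rw [divisionNorm_neg, divisionNorm_one, divisionNorm_pow] at h2
      exact (pow_lt_one₀ hx0.le hx1 (Nat.succ_ne_zero _)).ne h2)
    (fun i j hij y hy => pow_prime_mul_one_add_pow_ne_of_ne hx1 hxL (hsp i) (hsp j)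
      (hsinj i j hij) (hpx _ (hsm i)) (hpx _ (hsm j)) hy)
  set a : L := 1 + x ^ s t
  obtain ⟨α, hα⟩ := IsAlgClosed.exists_pow_nat_eq (algebraMap L K a) hp.pos
  let M := IntermediateField.adjoin L {α}
  have hM : FiniteDimensional L M := (finrank_adjoin_simple_le_of_pow_eq hp.ne_zero hα).1
  let αM : M := ⟨α, IntermediateField.mem_adjoin_simple_self L α⟩
  refine ⟨L, M, hL, ?_, hM, ?_, ?_⟩
  · rw [hLm]
    exact (Nat.coprime_mul_left_add_left _ _ _).mpr (Nat.coprime_one_left p)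
  · refine finrank_adjoin_simple_eq_of_pow_prime_eq hα fun b hb => ht _ (T.algebraMap_mem b) ?_
    rw [← map_pow, hb]
  · intro F _ _ _ _ _ _ hsurj
    have : FiniteDimensional k M := FiniteDimensional.trans k L M
    have := finiteDimensional_of_productMap_surjective hsurj
    refine nonempty_algEquiv_matrix_of_not_pow_prime (L := L) (K := K) (α := αM) hD T ?_ ht
      (Subtype.ext hα) ?_ hsurj
    · intro φ c
      exact IntermediateField.subset_adjoin L _ (φ.fieldRange_le_normalClosure ⟨c, rfl⟩)
    · intro y
      have hint : IsIntegral L α := Algebra.IsIntegral.isIntegral α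
      obtain ⟨f, hf⟩ := (IntermediateField.adjoin.powerBasis hint).exists_eq_aeval' y
      exact ⟨f, hf⟩

/-- Let `k` be a `p`-adic field and `E/k` a finite extension into which every
degree-`p` extension of `k` embeds over `k`. Let `D` be a central division algebra of degree
`p` over `E` (so `dim_E D = p²`). Then for every prime `ℓ` there are a finite extension `L/k`
of degree coprime to `ℓ` and a degree-`p` extension `M/L` such that `D ⊗_E (M ⊗_k E)` is
split. -/
theorem statement8 (p : ℕ) [Fact p.Prime] (k : Type) [Field k]
    [Algebra ℚ_[p] k] [FiniteDimensional ℚ_[p] k]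
    (E : Type) [Field E] [Algebra k E] [FiniteDimensional k E]
    (hE : ∀ (F : Type) [Field F] [Algebra k F], FiniteDimensional k F →
      finrank k F = p → Nonempty (F →ₐ[k] E))
    (D : Type) [DivisionRing D] [Algebra E D] [Algebra.IsCentral E D]
    (hD : finrank E D = p ^ 2)
    (ℓ : ℕ) (hℓ : ℓ.Prime) :
    ∃ (L : IntermediateField k (AlgebraicClosure k))
      (M : IntermediateField L (AlgebraicClosure k)),
      FiniteDimensional k L ∧ Nat.Coprime (finrank k L) ℓ ∧
      FiniteDimensional (↥L) (↥M) ∧ finrank (↥L) (↥M) = p ∧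
      CSASplitsOver k E D p M := by
  rcases eq_or_ne ℓ p with rfl | hℓp
  · exact exists_splitting_of_eq hD
  · exact exists_splitting_of_ne hD hℓ hℓp
end
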